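/- arXiv:math/0605552 — 7 statements merged into one kernel-verified Lean document; each statement's English description precedes it below -/
import Mathlib

section
/- Let W and W' be non-negative real random variables defined on the same probability space with the same distribution, let D := W' - W, and let λ > 0 be a constant. Let Z be an exponential random variable with mean 1. Then for every t > 0, |P(W ≤ t) − P(Z ≤ t)| ≤ E|(λ⁻¹E(D|W) + 1)·1[W > 0]| + E|(1/(2λ))E(D²|W) − 1| + (1/(6λ))E|D|³ + (1/(2λ))E(D²·1[|W − t| ≤ |D|]). -/
open MeasureTheory Real

/-- If a function has nonpositive derivative left of `a` and nonnegative derivative right of `a`,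
then it attains its minimum at `a`. -/
lemma le_of_hasDerivAt_sign {φ φ' : ℝ → ℝ} {a : ℝ} (hφ : ∀ x, HasDerivAt φ (φ' x) x)
    (hr : ∀ x, a ≤ x → 0 ≤ φ' x) (hl : ∀ x, x ≤ a → φ' x ≤ 0) (b : ℝ) : φ a ≤ φ b := by
  have hc : Continuous φ := continuous_iff_continuousAt.2 fun x => (hφ x).continuousAt
  rcases le_total a b with hab | hab
  · refine monotoneOn_of_deriv_nonneg (convex_Ici a) hc.continuousOn
      (fun x _ => (hφ x).differentiableAt.differentiableWithinAt) (fun x hx => ?_)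
      Set.self_mem_Ici hab hab
    rw [interior_Ici] at hx
    rw [(hφ x).deriv]
    exact hr x (le_of_lt hx)
  · refine antitoneOn_of_deriv_nonpos (convex_Iic a) hc.continuousOn
      (fun x _ => (hφ x).differentiableAt.differentiableWithinAt) (fun x hx => ?_)
      hab Set.self_mem_Iic hab
    rw [interior_Iic] at hx
    rw [(hφ x).deriv]
    exact hl x (le_of_lt hx)

/-- A primitive of `x ↦ exp (min x 0)`. -/
noncomputable def expMinPrimitive (x : ℝ) : ℝ := ∫ s in (0 : ℝ)..x, exp (min s 0)

lemma continuous_exp_min : Continuous fun s : ℝ => exp (min s 0) := by fun_prop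

lemma hasDerivAt_expMinPrimitive (x : ℝ) : HasDerivAt expMinPrimitive (exp (min x 0)) x :=
  (continuous_exp_min.integral_hasStrictDerivAt 0 x).hasDerivAt

lemma continuous_expMinPrimitive : Continuous expMinPrimitive :=
  continuous_iff_continuousAt.2 fun x => (hasDerivAt_expMinPrimitive x).continuousAt

lemma expMinPrimitive_sub (a b : ℝ) :
    expMinPrimitive b - expMinPrimitive a = ∫ s in a..b, exp (min s 0) :=
  intervalIntegral.integral_interval_sub_left (continuous_exp_min.intervalIntegrable _ _)
    (continuous_exp_min.intervalIntegrable _ _)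

lemma expMinPrimitive_sub_of_nonpos {a b : ℝ} (ha : a ≤ 0) (hb : b ≤ 0) :
    expMinPrimitive b - expMinPrimitive a = exp b - exp a := by
  rw [expMinPrimitive_sub, ← integral_exp]
  refine intervalIntegral.integral_congr fun s hs => ?_
  have : s ≤ 0 := hs.2.trans (max_le ha hb)
  simp [min_eq_left this]

lemma expMinPrimitive_sub_of_nonneg {a b : ℝ} (ha : 0 ≤ a) (hb : 0 ≤ b) :
    expMinPrimitive b - expMinPrimitive a = b - a := by
  rw [expMinPrimitive_sub]
  have : ∫ s in a..b, exp (min s 0) = ∫ _ in a..b, (1 : ℝ) := by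
    refine intervalIntegral.integral_congr fun s hs => ?_
    have : 0 ≤ s := (le_min ha hb).trans hs.1
    simp [min_eq_right this]
  rw [this]
  simp

lemma exp_min_sub_exp_min_le {a x : ℝ} (h : a ≤ x) :
    exp (min x 0) - exp (min a 0) ≤ x - a := by
  have h1 : min a 0 ≤ min x 0 := min_le_min_right 0 h
  have h2 : min x 0 - min a 0 ≤ x - a := by
    rcases le_total a 0 with h3 | h3 <;> rcases le_total x 0 with h4 | h4 <;>
      simp only [min_eq_left, min_eq_right, h3, h4] <;> linarith
  have h3 : exp (min x 0) ≤ 1 := exp_le_one_iff.2 (min_le_right _ _)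
  have h4 := add_one_le_exp (min a 0 - min x 0)
  have h5 : exp (min a 0) = exp (min x 0) * exp (min a 0 - min x 0) := by
    rw [← exp_add]; congr 1; ring
  have h6 := exp_pos (min x 0)
  nlinarith

lemma expMinPrimitive_tangent_nonneg (a b : ℝ) :
    0 ≤ expMinPrimitive b - expMinPrimitive a - exp (min a 0) * (b - a) := by
  have h := le_of_hasDerivAt_sign (a := a)
    (φ := fun x => expMinPrimitive x - expMinPrimitive a - exp (min a 0) * (x - a))
    (φ' := fun x => exp (min x 0) - exp (min a 0) * 1)
    (fun x => ((hasDerivAt_expMinPrimitive x).sub_const _).sub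
      (((hasDerivAt_id x).sub_const a).const_mul _))
    (fun x hx => by
      have : exp (min a 0) ≤ exp (min x 0) := exp_le_exp.2 (min_le_min_right 0 hx)
      linarith)
    (fun x hx => by
      have : exp (min x 0) ≤ exp (min a 0) := exp_le_exp.2 (min_le_min_right 0 hx)
      linarith) b
  simpa using h

lemma expMinPrimitive_tangent_le (a b : ℝ) :
    expMinPrimitive b - expMinPrimitive a - exp (min a 0) * (b - a) ≤ (b - a) ^ 2 / 2 := by
  have h := le_of_hasDerivAt_sign (a := a)
    (φ := fun x => (x - a) ^ 2 / 2 -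
      (expMinPrimitive x - expMinPrimitive a - exp (min a 0) * (x - a)))
    (φ' := fun x => (x - a) - (exp (min x 0) - exp (min a 0) * 1))
    (fun x => by
      have h1 : HasDerivAt (fun x : ℝ => (x - a) ^ 2 / 2) (x - a) x := by
        refine ((((hasDerivAt_id' x).sub_const a).pow 2).div_const 2).congr_deriv ?_
        norm_num
      exact h1.sub (((hasDerivAt_expMinPrimitive x).sub_const _).sub
        (((hasDerivAt_id x).sub_const a).const_mul _)))
    (fun x hx => by
      have := exp_min_sub_exp_min_le hx
      linarith)
    (fun x hx => by
      have := exp_min_sub_exp_min_le hx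
      linarith) b
  simp only [sub_self] at h
  norm_num at h
  linarith

lemma exp_neg_mul_quadratic_ge {d : ℝ} (hd : 0 ≤ d) :
    1 - exp (-d) * (1 + d + d ^ 2 / 2) ≤ d ^ 3 / 6 := by
  have hder : ∀ x : ℝ, HasDerivAt (fun x : ℝ => x ^ 3 / 6 + exp (-x) * (1 + x + x ^ 2 / 2))
      (x ^ 2 / 2 * (1 - exp (-x))) x := by
    intro x
    have h1 : HasDerivAt (fun x : ℝ => exp (-x)) (-exp (-x)) x := by
      simpa using (hasDerivAt_neg x).exp
    have h2 := ((hasDerivAt_pow 3 x).div_const 6).add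
      (h1.mul (((hasDerivAt_id x).const_add 1).add ((hasDerivAt_pow 2 x).div_const 2)))
    refine h2.congr_deriv ?_
    simp
    ring
  have h := monotoneOn_of_deriv_nonneg (convex_Ici (0 : ℝ))
    (fun x _ => (hder x).continuousAt.continuousWithinAt)
    (fun x _ => (hder x).differentiableAt.differentiableWithinAt) (fun x hx => by
      rw [interior_Ici] at hx
      rw [(hder x).deriv]
      have : exp (-x) ≤ 1 := exp_le_one_iff.2 (by linarith [Set.mem_Ioi.1 hx])
      exact mul_nonneg (by positivity) (by linarith))
    Set.self_mem_Ici (Set.mem_Ici.2 hd) hd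
  norm_num at h
  linarith

lemma exp_le_quadratic_of_nonpos {d : ℝ} (hd : d ≤ 0) : exp d ≤ 1 + d + d ^ 2 / 2 := by
  have hder : ∀ x : ℝ, HasDerivAt (fun x : ℝ => exp x - (1 + x + x ^ 2 / 2))
      (exp x - (1 + x)) x := by
    intro x
    refine ((hasDerivAt_exp x).sub (((hasDerivAt_id' x).const_add 1).add
      ((hasDerivAt_pow 2 x).div_const 2))).congr_deriv ?_
    norm_num
  have h := monotoneOn_of_deriv_nonneg (convex_Iic (0 : ℝ))
    (fun x _ => (hder x).continuousAt.continuousWithinAt)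
    (fun x _ => (hder x).differentiableAt.differentiableWithinAt) (fun x _ => by
      rw [(hder x).deriv]
      linarith [add_one_le_exp x])
    (Set.mem_Iic.2 hd) Set.self_mem_Iic hd
  norm_num at h
  linarith

lemma cubic_le_exp_of_nonpos {d : ℝ} (hd : d ≤ 0) :
    1 + d + d ^ 2 / 2 + d ^ 3 / 6 ≤ exp d := by
  have hder : ∀ x : ℝ, HasDerivAt (fun x : ℝ => exp x - (1 + x + x ^ 2 / 2 + x ^ 3 / 6))
      (exp x - (1 + x + x ^ 2 / 2)) x := by
    intro x
    refine ((hasDerivAt_exp x).sub ((((hasDerivAt_id' x).const_add 1).add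
      ((hasDerivAt_pow 2 x).div_const 2)).add ((hasDerivAt_pow 3 x).div_const 6))).congr_deriv ?_
    norm_num
    ring
  have h := antitoneOn_of_deriv_nonpos (convex_Iic (0 : ℝ))
    (fun x _ => (hder x).continuousAt.continuousWithinAt)
    (fun x _ => (hder x).differentiableAt.differentiableWithinAt) (fun x hx => by
      rw [interior_Iic] at hx
      rw [(hder x).deriv]
      linarith [exp_le_quadratic_of_nonpos (le_of_lt hx)])
    (Set.mem_Iic.2 hd) Set.self_mem_Iic hd
  norm_num at h
  linarith

/-- Second order Taylor remainder of `exp` at a point, when both end points are nonpositive. -/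
lemma abs_exp_taylor_le {a d : ℝ} (ha : a ≤ 0) (hd : a + d ≤ 0) :
    |exp a * (exp d - 1 - d - d ^ 2 / 2)| ≤ |d| ^ 3 / 6 := by
  have hea : exp a ≤ 1 := exp_le_one_iff.2 ha
  have hpos := exp_pos a
  rw [abs_mul, abs_of_pos hpos]
  rcases le_total 0 d with h | h
  · have h0 : 0 ≤ exp d - 1 - d - d ^ 2 / 2 := by
      linarith [quadratic_le_exp_of_nonneg h]
    rw [abs_of_nonneg h0, abs_of_nonneg h]
    have h1 : exp a ≤ exp (-d) := exp_le_exp.2 (by linarith)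
    have h2 : exp (-d) * (exp d - 1 - d - d ^ 2 / 2)
        = 1 - exp (-d) * (1 + d + d ^ 2 / 2) := by
      have : exp (-d) * exp d = 1 := by rw [← exp_add]; simp
      linear_combination this
    have h3 := exp_neg_mul_quadratic_ge h
    have h4 := mul_le_mul_of_nonneg_right h1 h0
    linarith
  · have key : |exp d - 1 - d - d ^ 2 / 2| ≤ |d| ^ 3 / 6 := by
      have h1 := exp_le_quadratic_of_nonpos h
      have h2 := cubic_le_exp_of_nonpos h
      rw [abs_of_nonpos (by linarith), abs_of_nonpos h]
      linarith [show (-d) ^ 3 = -d ^ 3 by ring]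
    calc exp a * |exp d - 1 - d - d ^ 2 / 2| ≤ 1 * |exp d - 1 - d - d ^ 2 / 2| := by gcongr
      _ ≤ _ := by linarith

/-- Second order Taylor remainder of `expMinPrimitive`. -/
lemma abs_expMinPrimitive_taylor_le (a b : ℝ) :
    |expMinPrimitive b - expMinPrimitive a - exp (min a 0) * (b - a)
      - (if a ≤ 0 then exp a else 0) * ((b - a) ^ 2 / 2)| ≤
    |b - a| ^ 3 / 6 + if |a| ≤ |b - a| then (b - a) ^ 2 / 2 else 0 := by
  have hcube : 0 ≤ |b - a| ^ 3 / 6 := by positivity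
  split_ifs with ha h h
  · have h1 := expMinPrimitive_tangent_nonneg a b
    have h2 := expMinPrimitive_tangent_le a b
    have h3 : exp a * ((b - a) ^ 2 / 2) ≤ 1 * ((b - a) ^ 2 / 2) := by
      gcongr; exact exp_le_one_iff.2 ha
    have h4 : 0 ≤ exp a * ((b - a) ^ 2 / 2) := by positivity
    rw [abs_le]; constructor <;> linarith
  · have hb : b ≤ 0 := by
      rw [abs_of_nonpos ha] at h
      linarith [le_abs_self (b - a)]
    rw [expMinPrimitive_sub_of_nonpos ha hb, min_eq_left ha, add_zero]
    have := abs_exp_taylor_le (a := a) (d := b - a) ha (by linarith)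
    have h5 : exp b = exp a * exp (b - a) := by rw [← exp_add]; congr 1; ring
    rw [h5]
    convert this using 2
    ring
  · have h1 := expMinPrimitive_tangent_nonneg a b
    have h2 := expMinPrimitive_tangent_le a b
    rw [abs_le]; constructor <;> linarith
  · have ha' : 0 ≤ a := (not_le.1 ha).le
    have hb : 0 ≤ b := by
      rw [abs_of_nonneg ha'] at h
      linarith [neg_abs_le (b - a)]
    rw [expMinPrimitive_sub_of_nonneg ha' hb, min_eq_right ha']
    simpa using hcube

/-- Two identically distributed random variables whose difference is integrable have a difference
of mean zero, even if they are not integrable themselves. -/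
lemma integral_sub_eq_zero_of_map_eq {Ω : Type*} [MeasurableSpace Ω] {μ : Measure Ω}
    [IsFiniteMeasure μ] {X Y : Ω → ℝ} (hX : Measurable X) (hY : Measurable Y)
    (h : μ.map X = μ.map Y) (hint : Integrable (fun ω => Y ω - X ω) μ) :
    ∫ ω, (Y ω - X ω) ∂μ = 0 := by
  let c : ℕ → ℝ → ℝ := fun n x => max (-(n : ℝ)) (min (n : ℝ) x)
  have hc : ∀ n, Measurable (c n) := fun n => by fun_prop
  have hcb : ∀ n x, |c n x| ≤ n := fun n x =>
    abs_le.2 ⟨le_max_left _ _,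
      max_le (by linarith [(Nat.cast_nonneg n : (0 : ℝ) ≤ n)]) (min_le_left _ _)⟩
  have hi : ∀ n {V : Ω → ℝ}, Measurable V → Integrable (fun ω => c n (V ω)) μ := fun n V hV =>
    Integrable.of_bound ((hc n).comp hV).aestronglyMeasurable n (.of_forall fun ω => hcb n _)
  have hz : ∀ n, ∫ ω, (c n (Y ω) - c n (X ω)) ∂μ = 0 := fun n => by
    rw [integral_sub (hi n hY) (hi n hX),
      ← integral_map hY.aemeasurable (hc n).aestronglyMeasurable,
      ← integral_map hX.aemeasurable (hc n).aestronglyMeasurable, h, sub_self]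
  have hlim := tendsto_integral_of_dominated_convergence (μ := μ)
    (F := fun n ω => c n (Y ω) - c n (X ω)) (f := fun ω => Y ω - X ω)
    (fun ω => |Y ω - X ω|)
    (fun n => (((hc n).comp hY).sub ((hc n).comp hX)).aestronglyMeasurable) hint.abs
    (fun n => .of_forall fun ω =>
      (abs_max_sub_max_le_max _ _ _ _).trans <| max_le (by simp) <|
        (abs_min_sub_min_le_max _ _ _ _).trans <| max_le (by simp) le_rfl)
    (.of_forall fun ω => by
      have hev : ∀ x : ℝ, ∀ᶠ n : ℕ in Filter.atTop, c n x = x := fun x => by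
        filter_upwards [Filter.eventually_ge_atTop ⌈|x|⌉₊] with n hn
        have hx : |x| ≤ n := (Nat.le_ceil _).trans (by exact_mod_cast hn)
        have := abs_le.1 hx
        simp only [c]
        rw [min_eq_right this.2, max_eq_right this.1]
      refine tendsto_const_nhds.congr' ?_
      filter_upwards [hev (Y ω), hev (X ω)] with n h1 h2
      rw [h1, h2])
  simp only [hz] at hlim
  exact tendsto_nhds_unique hlim tendsto_const_nhds

/-- A bounded `σ(W)`-measurable factor can be paired with the conditional expectation given `W`. -/
lemma integral_mul_condExp_comap {Ω : Type*} [MeasurableSpace Ω] {μ : Measure Ω}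
    [IsFiniteMeasure μ] {W X : Ω → ℝ} (hW : Measurable W) (hX : Integrable X μ)
    {f : ℝ → ℝ} (hf : Measurable f) {C : ℝ} (hfC : ∀ ω, |f (W ω)| ≤ C) :
    ∫ ω, f (W ω) * (μ[X | MeasurableSpace.comap W inferInstance]) ω ∂μ
      = ∫ ω, f (W ω) * X ω ∂μ := by
  have hm : MeasurableSpace.comap W inferInstance ≤ ‹MeasurableSpace Ω› := hW.comap_le
  have hs : StronglyMeasurable[MeasurableSpace.comap W inferInstance] (fun ω => f (W ω)) :=
    (hf.comp (comap_measurable W)).stronglyMeasurable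
  have hi : Integrable ((fun ω => f (W ω)) * X) μ :=
    hX.bdd_mul (hf.comp hW).aestronglyMeasurable (.of_forall hfC)
  rw [← integral_condExp hm (f := fun ω => f (W ω) * X ω)]
  exact (integral_congr_ae (condExp_mul_of_stronglyMeasurable_left hs hi hX)).symm

/-- Theorem 1.1 (atheorem1): Berry-Esséen bound for the exponential law, version 1. -/
theorem exponential_berry_esseen_v1
    {Ω : Type*} [MeasurableSpace Ω] {μ : Measure Ω} [IsProbabilityMeasure μ]
    (W W' : Ω → ℝ) (hW : Measurable W) (hW' : Measurable W')
    (hWnn : ∀ ω, 0 ≤ W ω) (hW'nn : ∀ ω, 0 ≤ W' ω)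
    (hdist : μ.map W = μ.map W')
    (lam : ℝ) (hlam : 0 < lam)
    (D : Ω → ℝ) (hDdef : D = fun ω => W' ω - W ω)
    (hD1 : Integrable D μ)
    (hD2 : Integrable (fun ω => (D ω) ^ 2) μ)
    (hD3 : Integrable (fun ω => |D ω| ^ 3) μ)
    (t : ℝ) (ht : 0 < t) :
    |(μ {ω | W ω ≤ t}).toReal - (1 - Real.exp (-t))| ≤
      (∫ ω, |(lam⁻¹ * (μ[D | MeasurableSpace.comap W inferInstance]) ω + 1) *
          Set.indicator {ω' | 0 < W ω'} (fun _ => (1 : ℝ)) ω| ∂μ)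
      + (∫ ω, |(1 / (2 * lam)) *
          (μ[(fun ω' => (D ω') ^ 2) | MeasurableSpace.comap W inferInstance]) ω - 1| ∂μ)
      + (1 / (6 * lam)) * (∫ ω, |D ω| ^ 3 ∂μ)
      + (1 / (2 * lam)) *
          (∫ ω, (D ω) ^ 2 * Set.indicator {ω' | |W ω' - t| ≤ |D ω'|} (fun _ => (1 : ℝ)) ω ∂μ) := by
  have hDm : Measurable D := by rw [hDdef]; exact hW'.sub hW
  have hD : ∀ ω, D ω = W' ω - W ω := fun ω => by rw [hDdef]
  clear hDdef
  set A := μ[D | MeasurableSpace.comap W inferInstance]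
  set B := μ[(fun ω' => (D ω') ^ 2) | MeasurableSpace.comap W inferInstance]
  have hAi : Integrable A μ := integrable_condExp
  have hBi : Integrable B μ := integrable_condExp
  let f : ℝ → ℝ := fun x => exp (min (x - t) 0) - exp (-t)
  let p : ℝ → ℝ := fun x => if x - t ≤ 0 then exp (x - t) else 0
  let F : ℝ → ℝ := fun x => expMinPrimitive (x - t) - exp (-t) * x
  let S : Set Ω := {ω' | |W ω' - t| ≤ |D ω'|}
  let Q : Ω → ℝ := fun ω => (D ω) ^ 2 * S.indicator (fun _ => (1 : ℝ)) ω
  let r : Ω → ℝ := fun ω => F (W' ω) - F (W ω) - f (W ω) * D ω - p (W ω) * (D ω ^ 2 / 2)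
  have hSm : MeasurableSet S := measurableSet_le (hW.sub_const t).abs hDm.abs
  have hfm : Measurable f := by fun_prop
  have hpm : Measurable p := Measurable.ite
    (measurableSet_le (measurable_id.sub_const t) measurable_const) (by fun_prop) measurable_const
  have hFm : Measurable F :=
    ((continuous_expMinPrimitive.comp (continuous_id.sub continuous_const)).sub
      (continuous_const.mul continuous_id)).measurable
  have hf0 : ∀ x, 0 ≤ x → 0 ≤ f x := fun x hx =>
    sub_nonneg.2 (exp_le_exp.2 (le_min (by linarith) (by linarith)))
  have hf1 : ∀ x, f x ≤ 1 := fun x => by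
    have h1 : exp (min (x - t) 0) ≤ 1 := exp_le_one_iff.2 (min_le_right _ _)
    have h2 := exp_pos (-t)
    simp only [f]; linarith
  have hp0 : ∀ x, 0 ≤ p x := fun x => by
    simp only [p]; split_ifs <;> positivity
  have hp1 : ∀ x, p x ≤ 1 := fun x => by
    simp only [p]; split_ifs with h
    · exact exp_le_one_iff.2 h
    · exact zero_le_one
  have hfb : ∀ ω, |f (W ω)| ≤ 1 := fun ω => by
    rw [abs_of_nonneg (hf0 _ (hWnn ω))]; exact hf1 _
  have hpb : ∀ ω, |p (W ω)| ≤ 1 := fun ω => by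
    rw [abs_of_nonneg (hp0 _)]; exact hp1 _
  have hmulf : ∀ {X : Ω → ℝ}, Integrable X μ → Integrable (fun ω => f (W ω) * X ω) μ :=
    fun hX => hX.bdd_mul (hfm.comp hW).aestronglyMeasurable (.of_forall hfb)
  have hmulp : ∀ {X : Ω → ℝ}, Integrable X μ → Integrable (fun ω => p (W ω) * X ω) μ :=
    fun hX => hX.bdd_mul (hpm.comp hW).aestronglyMeasurable (.of_forall hpb)
  have hQ : Integrable Q μ := by
    have : Q = S.indicator fun ω => D ω ^ 2 := by
      ext ω; by_cases h : ω ∈ S <;> simp [Q, h]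
    rw [this]
    exact hD2.indicator hSm
  have hrle : ∀ ω, |r ω| ≤ |D ω| ^ 3 / 6 + Q ω / 2 := fun ω => by
    have h := abs_expMinPrimitive_taylor_le (W ω - t) (W' ω - t)
    have hd : W' ω - t - (W ω - t) = D ω := by rw [hD]; ring
    rw [hd] at h
    have hr : r ω = expMinPrimitive (W' ω - t) - expMinPrimitive (W ω - t)
        - exp (min (W ω - t) 0) * D ω
        - (if W ω - t ≤ 0 then exp (W ω - t) else 0) * (D ω ^ 2 / 2) := by
      simp only [r, F, f, p]
      linear_combination exp (-t) * hD ω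
    have hq : (if |W ω - t| ≤ |D ω| then D ω ^ 2 / 2 else 0) = Q ω / 2 := by
      simp only [Q, S, Set.indicator_apply, Set.mem_ofPred_eq]
      split_ifs <;> ring
    rw [hr, ← hq]
    exact h
  have hri : Integrable r μ := by
    refine ((hD3.div_const 6).add (hQ.div_const 2)).mono' ?_ (.of_forall hrle)
    exact ((((hFm.comp hW').sub (hFm.comp hW)).sub ((hfm.comp hW).mul hDm)).sub
      ((hpm.comp hW).mul ((hDm.pow_const 2).div_const 2))).aestronglyMeasurable
  have hfD := hmulf hD1
  have hpD := hmulp hD2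
  have hbalance : ∫ ω, f (W ω) * D ω ∂μ + (∫ ω, p (W ω) * D ω ^ 2 ∂μ) / 2 + ∫ ω, r ω ∂μ = 0 := by
    have hsplit : (fun ω => F (W' ω) - F (W ω))
        = fun ω => f (W ω) * D ω + p (W ω) * D ω ^ 2 / 2 + r ω := by
      ext ω; simp only [r]; ring
    have hmap : μ.map (fun ω => F (W ω)) = μ.map fun ω => F (W' ω) := by
      have h1 := Measure.map_map (μ := μ) hFm hW
      have h2 := Measure.map_map (μ := μ) hFm hW'
      rw [hdist, h2] at h1
      exact h1.symm
    have h12 : Integrable (fun ω => f (W ω) * D ω + p (W ω) * D ω ^ 2 / 2) μ :=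
      hfD.add (hpD.div_const 2)
    have h := integral_sub_eq_zero_of_map_eq (hFm.comp hW) (hFm.comp hW') hmap
      (by rw [show (fun ω => (F ∘ W') ω - (F ∘ W) ω) = _ from hsplit]; exact h12.add hri)
    rw [show (fun ω => (F ∘ W') ω - (F ∘ W) ω) = _ from hsplit, integral_add h12 hri,
      integral_add hfD (hpD.div_const 2), integral_div] at h
    exact h
  have hfA : ∫ ω, f (W ω) * A ω ∂μ = ∫ ω, f (W ω) * D ω ∂μ :=
    integral_mul_condExp_comap hW hD1 hfm hfb
  have hpB : ∫ ω, p (W ω) * B ω ∂μ = ∫ ω, p (W ω) * D ω ^ 2 ∂μ :=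
    integral_mul_condExp_comap hW hD2 hpm hpb
  have hstein : (μ {ω | W ω ≤ t}).toReal - (1 - exp (-t))
      = ∫ ω, p (W ω) * 1 ∂μ - ∫ ω, f (W ω) * 1 ∂μ := by
    have hm : MeasurableSet {ω | W ω ≤ t} := measurableSet_le hW measurable_const
    have h1 : ∫ ω, {ω | W ω ≤ t}.indicator (fun _ => (1 : ℝ)) ω ∂μ
        = (μ {ω | W ω ≤ t}).toReal := by
      rw [integral_indicator_const _ hm]; simp [Measure.real]
    have h2 : ∫ _, (1 - exp (-t)) ∂μ = 1 - exp (-t) := by simp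
    rw [← integral_sub (hmulp (integrable_const _)) (hmulf (integrable_const _)), ← h1]
    nth_rewrite 1 [← h2]
    rw [← integral_sub ((integrable_const _).indicator hm) (integrable_const _)]
    refine integral_congr_ae (.of_forall fun ω => ?_)
    simp only [p, f, Set.indicator_apply, Set.mem_ofPred_eq, sub_nonpos]
    split_ifs with h
    · rw [min_eq_left (by linarith)]; ring
    · rw [min_eq_right (by linarith), exp_zero]; ring
  let U : Ω → ℝ := fun ω => lam⁻¹ * A ω + 1
  let V : Ω → ℝ := fun ω => 1 / (2 * lam) * B ω - 1
  have hUi : Integrable U μ := (hAi.const_mul _).add (integrable_const _)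
  have hVi : Integrable V μ := (hBi.const_mul _).sub (integrable_const _)
  have hfU : ∫ ω, f (W ω) * U ω ∂μ
      = lam⁻¹ * ∫ ω, f (W ω) * D ω ∂μ + ∫ ω, f (W ω) * 1 ∂μ := by
    rw [← hfA, ← integral_const_mul,
      ← integral_add ((hmulf hAi).const_mul _) (hmulf (integrable_const _))]
    congr 1 with ω
    simp only [U]; ring
  have hpV : ∫ ω, p (W ω) * V ω ∂μ
      = 1 / (2 * lam) * ∫ ω, p (W ω) * D ω ^ 2 ∂μ - ∫ ω, p (W ω) * 1 ∂μ := by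
    rw [← hpB, ← integral_const_mul,
      ← integral_sub ((hmulp hBi).const_mul _) (hmulp (integrable_const _))]
    congr 1 with ω
    simp only [V]; ring
  have hdecomp : (μ {ω | W ω ≤ t}).toReal - (1 - exp (-t))
      = -(∫ ω, f (W ω) * U ω ∂μ) - ∫ ω, p (W ω) * V ω ∂μ - lam⁻¹ * ∫ ω, r ω ∂μ := by
    rw [hstein, hfU, hpV]
    have : 1 / (2 * lam) = lam⁻¹ / 2 := by field_simp
    rw [this]
    linear_combination lam⁻¹ * hbalance
  have hWm : MeasurableSet {ω | 0 < W ω} := measurableSet_lt measurable_const hW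
  have hbU : |∫ ω, f (W ω) * U ω ∂μ|
      ≤ ∫ ω, |U ω * {ω' | 0 < W ω'}.indicator (fun _ => (1 : ℝ)) ω| ∂μ := by
    refine abs_integral_le_integral_abs.trans (integral_mono (hmulf hUi).abs ?_ fun ω => ?_)
    · have : (fun ω => U ω * {ω' | 0 < W ω'}.indicator (fun _ => (1 : ℝ)) ω)
          = {ω' | 0 < W ω'}.indicator U := by
        ext ω; by_cases h : 0 < W ω <;> simp [h]
      exact (this ▸ hUi.indicator hWm).abs
    · by_cases h : 0 < W ω
      · simpa [h, abs_mul] using mul_le_mul_of_nonneg_right (hfb ω) (abs_nonneg (U ω))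
      · have h0 : W ω = 0 := le_antisymm (not_lt.1 h) (hWnn ω)
        have : f 0 = 0 := by
          simp only [f]; rw [min_eq_left (by linarith)]; simp
        simp [h0, this]
  have hbV : |∫ ω, p (W ω) * V ω ∂μ| ≤ ∫ ω, |V ω| ∂μ := by
    refine abs_integral_le_integral_abs.trans (integral_mono (hmulp hVi).abs hVi.abs fun ω => ?_)
    simpa [abs_mul] using mul_le_mul_of_nonneg_right (hpb ω) (abs_nonneg (V ω))
  have hbr : |∫ ω, r ω ∂μ| ≤ (∫ ω, |D ω| ^ 3 ∂μ) / 6 + (∫ ω, Q ω ∂μ) / 2 := by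
    rw [← integral_div, ← integral_div,
      ← integral_add (hD3.div_const 6) (hQ.div_const 2)]
    exact abs_integral_le_integral_abs.trans
      (integral_mono hri.abs ((hD3.div_const 6).add (hQ.div_const 2)) hrle)
  have hbr' : |lam⁻¹ * ∫ ω, r ω ∂μ|
      ≤ 1 / (6 * lam) * ∫ ω, |D ω| ^ 3 ∂μ + 1 / (2 * lam) * ∫ ω, Q ω ∂μ := by
    rw [abs_mul, abs_of_pos (inv_pos.2 hlam)]
    refine (mul_le_mul_of_nonneg_left hbr (inv_pos.2 hlam).le).trans_eq ?_
    field_simp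
  rw [hdecomp]
  refine (abs_sub _ _).trans ((add_le_add ((abs_sub _ _).trans
    (add_le_add (abs_neg _).le le_rfl)) le_rfl).trans ?_)
  change _ ≤ ∫ ω, |U ω * {ω' | 0 < W ω'}.indicator (fun _ => (1 : ℝ)) ω| ∂μ + ∫ ω, |V ω| ∂μ
    + 1 / (6 * lam) * ∫ ω, |D ω| ^ 3 ∂μ + 1 / (2 * lam) * ∫ ω, Q ω ∂μ
  linarith
end

section
/- Let W and W' be non-negative real random variables defined on the same probability space with the same distribution, let D := W' − W, and suppose E(D|W) = −λ(W − 1) almost surely for a fixed constant λ > 0. Let Z be an exponential random variable with mean 1. Then for every t > 0, |P(W ≤ t) − P(Z ≤ t)| ≤ E|2λW − E(D²|W)|/(2λt) + (E|D|³·max{t⁻¹, 2t⁻²})/(6λ) + E(D²·1[|W − t| ≤ |D|])/(λt). -/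
open MeasureTheory Real

/-- The `k`-th derivative of `x ↦ (exp x - 1) / x`, extended continuously to `x = 0`. -/
noncomputable def expMoment (k : ℕ) (x : ℝ) : ℝ := ∫ u in (0 : ℝ)..1, u ^ k * exp (u * x)

lemma hasDerivAt_expMoment (k : ℕ) (x : ℝ) :
    HasDerivAt (expMoment k) (expMoment (k + 1) x) x := by
  have h := intervalIntegral.hasDerivAt_integral_of_dominated_loc_of_deriv_le
    (F := fun x u : ℝ => u ^ k * exp (u * x)) (F' := fun x u : ℝ => u ^ (k + 1) * exp (u * x))
    (x₀ := x) (s := Metric.ball x 1) (a := 0) (b := 1) (μ := volume)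
    (bound := fun _ => exp (|x| + 1))
    (Metric.ball_mem_nhds x one_pos)
    (.of_forall fun y =>
      (by fun_prop : Continuous fun u : ℝ => u ^ k * exp (u * y)).aestronglyMeasurable)
    ((by fun_prop : Continuous fun u : ℝ => u ^ k * exp (u * x)).intervalIntegrable _ _)
    (by fun_prop : Continuous fun u : ℝ => u ^ (k + 1) * exp (u * x)).aestronglyMeasurable
    (.of_forall fun u hu y hy => ?_) intervalIntegrable_const
    (.of_forall fun u _ y _ => ?_)
  · exact h.2
  · rw [Set.uIoc_of_le zero_le_one] at hu
    rw [Metric.mem_ball, dist_eq] at hy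
    have hy' : |y| ≤ |x| + 1 := by
      have := abs_add_le (y - x) x
      simp only [sub_add_cancel] at this
      linarith
    rw [norm_of_nonneg (mul_nonneg (pow_nonneg hu.1.le _) (exp_pos _).le)]
    calc u ^ (k + 1) * exp (u * y) ≤ 1 * exp (|x| + 1) := by
          gcongr
          · exact pow_le_one₀ hu.1.le hu.2
          · nlinarith [le_abs_self y, abs_nonneg y, hu.1, hu.2]
      _ = _ := one_mul _
  · refine (((hasDerivAt_id y).const_mul u).exp.const_mul (u ^ k)).congr_deriv ?_
    simp only [id]
    ring

lemma mul_expMoment_zero (x : ℝ) : x * expMoment 0 x = exp x - 1 := by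
  have h : ∀ u ∈ Set.uIcc (0 : ℝ) 1, HasDerivAt (fun u => exp (u * x)) (x * exp (u * x)) u := by
    intro u _
    refine ((hasDerivAt_id u).mul_const x).exp.congr_deriv ?_
    simp [mul_comm]
  have h2 := intervalIntegral.integral_eq_sub_of_hasDerivAt h
    ((by fun_prop : Continuous fun u : ℝ => x * exp (u * x)).intervalIntegrable _ _)
  rw [intervalIntegral.integral_const_mul] at h2
  simp [expMoment, h2]

lemma expMoment_zero_add_mul_expMoment_one (x : ℝ) :
    expMoment 0 x + x * expMoment 1 x = exp x := by
  have h1 := (hasDerivAt_id x).mul (hasDerivAt_expMoment 0 x)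
  have h2 : HasDerivAt (fun y => exp y - 1) (exp x) x := (Real.hasDerivAt_exp x).sub_const 1
  have h3 : id * expMoment 0 = fun y => exp y - 1 := funext mul_expMoment_zero
  rw [h3] at h1
  simpa using h1.unique h2

lemma expMoment_nonneg (k : ℕ) (x : ℝ) : 0 ≤ expMoment k x :=
  intervalIntegral.integral_nonneg zero_le_one fun _ hu =>
    mul_nonneg (pow_nonneg hu.1 _) (exp_pos _).le

lemma expMoment_le_expMoment_zero (k : ℕ) {x y : ℝ} (hxy : x ≤ y) :
    expMoment k x ≤ expMoment 0 y := by
  refine intervalIntegral.integral_mono_on zero_le_one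
    ((by fun_prop : Continuous fun u : ℝ => u ^ k * exp (u * x)).intervalIntegrable _ _)
    ((by fun_prop : Continuous fun u : ℝ => u ^ 0 * exp (u * y)).intervalIntegrable _ _)
    fun u hu => ?_
  rw [pow_zero]
  gcongr
  · exact pow_le_one₀ hu.1 hu.2
  · exact hu.1

lemma abs_exp_neg_mul_expMoment_le (k : ℕ) {t x : ℝ} (ht : 0 < t) (hx : x ≤ t) :
    |exp (-t) * expMoment k x| ≤ t⁻¹ := by
  rw [abs_of_nonneg (mul_nonneg (exp_pos _).le (expMoment_nonneg k x))]
  calc exp (-t) * expMoment k x ≤ exp (-t) * expMoment 0 t := by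
        gcongr
        exact expMoment_le_expMoment_zero k hx
    _ ≤ t⁻¹ := by
        rw [← mul_one t⁻¹, le_inv_mul_iff₀ ht, mul_left_comm, mul_expMoment_zero, mul_sub,
          ← exp_add]
        simp [exp_nonneg]

/-- The bounded solution `f` of the Stein equation
`x * f' x - (x - 1) * f x = 1_{x ≤ t} - (1 - exp (-t))` of the exponential distribution. -/
noncomputable def expStein (t x : ℝ) : ℝ :=
  if x ≤ t then exp (-t) * expMoment 0 x else (1 - exp (-t)) / x

/-- The derivative of `expStein t` away from `t`, and its left derivative at `t`. -/
noncomputable def expSteinDeriv (t x : ℝ) : ℝ :=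
  if x ≤ t then exp (-t) * expMoment 1 x else -(1 - exp (-t)) / x ^ 2

lemma mul_expSteinDeriv_sub {t x : ℝ} (ht : 0 < t) :
    x * expSteinDeriv t x - (x - 1) * expStein t x
      = (if x ≤ t then 1 else 0) - (1 - exp (-t)) := by
  unfold expSteinDeriv expStein
  split_ifs with h
  · have h1 := mul_expMoment_zero x
    have h2 := expMoment_zero_add_mul_expMoment_one x
    linear_combination exp (-t) * h2 - exp (-t) * h1
  · have : x ≠ 0 := by linarith [not_le.1 h]
    field_simp
    ring

lemma one_sub_exp_neg_mem {t : ℝ} (ht : 0 < t) :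
    0 ≤ 1 - exp (-t) ∧ 1 - exp (-t) ≤ 1 ∧ 1 - exp (-t) ≤ t := by
  refine ⟨?_, ?_, ?_⟩
  · simpa using ht.le
  · linarith [exp_pos (-t)]
  · linarith [add_one_le_exp (-t)]

lemma expStein_of_ge {t x : ℝ} (ht : 0 < t) (hx : t ≤ x) :
    expStein t x = (1 - exp (-t)) / x := by
  unfold expStein
  split_ifs with h
  · obtain rfl : x = t := le_antisymm h hx
    rw [eq_div_iff ht.ne', mul_assoc, mul_comm _ x, mul_expMoment_zero, mul_sub, ← exp_add]
    simp
  · rfl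

lemma abs_expStein_le {t : ℝ} (ht : 0 < t) (x : ℝ) : |expStein t x| ≤ t⁻¹ := by
  obtain ⟨hp0, hp1, -⟩ := one_sub_exp_neg_mem ht
  rcases le_total x t with h | h
  · rw [expStein, if_pos h]
    exact abs_exp_neg_mul_expMoment_le 0 ht h
  · rw [expStein_of_ge ht h, abs_of_nonneg (div_nonneg hp0 (ht.le.trans h)), ← one_div]
    gcongr

lemma abs_neg_one_sub_exp_neg_div_sq_le {t x : ℝ} (ht : 0 < t) (hx : t ≤ x) :
    |-(1 - exp (-t)) / x ^ 2| ≤ t⁻¹ := by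
  obtain ⟨hp0, -, hpt⟩ := one_sub_exp_neg_mem ht
  rw [neg_div, abs_neg, abs_of_nonneg (by positivity)]
  calc (1 - exp (-t)) / x ^ 2 ≤ t / t ^ 2 := by gcongr
    _ = t⁻¹ := by field_simp

lemma abs_expSteinDeriv_le {t : ℝ} (ht : 0 < t) (x : ℝ) : |expSteinDeriv t x| ≤ t⁻¹ := by
  unfold expSteinDeriv
  split_ifs with h
  · exact abs_exp_neg_mul_expMoment_le 1 ht h
  · exact abs_neg_one_sub_exp_neg_div_sq_le ht (not_le.1 h).le

lemma continuous_expMoment (k : ℕ) : Continuous (expMoment k) :=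
  continuous_iff_continuousAt.2 fun x => (hasDerivAt_expMoment k x).continuousAt

lemma measurable_expSteinDeriv (t : ℝ) : Measurable (expSteinDeriv t) := by
  refine Measurable.ite measurableSet_Iic ?_ (by fun_prop)
  exact (continuous_expMoment 1).measurable.const_mul _

lemma hasDerivAt_const_div {x : ℝ} (p : ℝ) (hx : x ≠ 0) :
    HasDerivAt (fun y => p / y) (-p / x ^ 2) x := by
  refine ((hasDerivAt_inv hx).const_mul p).congr_deriv ?_
  ring

lemma hasDerivAt_const_div_sq {x : ℝ} (p : ℝ) (hx : x ≠ 0) :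
    HasDerivAt (fun y => -p / y ^ 2) (2 * p / x ^ 3) x := by
  refine (((hasDerivAt_pow 2 x).inv (pow_ne_zero 2 hx)).const_mul (-p)).congr_deriv ?_
  field_simp
  norm_num
  ring

lemma hasDerivAt_expStein {t x : ℝ} (ht : 0 < t) (hx : x ≠ t) :
    HasDerivAt (expStein t) (expSteinDeriv t x) x := by
  rcases hx.lt_or_gt with h | h
  · rw [expSteinDeriv, if_pos h.le]
    refine ((hasDerivAt_expMoment 0 x).const_mul (exp (-t))).congr_of_eventuallyEq ?_
    filter_upwards [Iio_mem_nhds h] with y hy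
    exact if_pos (le_of_lt hy)
  · rw [expSteinDeriv, if_neg (not_le.2 h)]
    refine (hasDerivAt_const_div _ (ht.trans h).ne').congr_of_eventuallyEq ?_
    filter_upwards [Ioi_mem_nhds h] with y hy
    exact if_neg (not_le.2 hy)

lemma abs_expStein_sub_le {t : ℝ} (ht : 0 < t) (x y : ℝ) :
    |expStein t y - expStein t x| ≤ t⁻¹ * |y - x| := by
  have hleft : ∀ x y, x ≤ t → y ≤ t → |expStein t y - expStein t x| ≤ t⁻¹ * |y - x| := by
    intro x y hx hy
    rw [expStein, expStein, if_pos hx, if_pos hy]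
    exact (convex_Iic t).norm_image_sub_le_of_norm_hasDerivWithin_le
      (fun z _ => ((hasDerivAt_expMoment 0 z).const_mul (exp (-t))).hasDerivWithinAt)
      (fun z hz => abs_exp_neg_mul_expMoment_le 1 ht hz) hx hy
  have hright : ∀ x y, t ≤ x → t ≤ y → |expStein t y - expStein t x| ≤ t⁻¹ * |y - x| := by
    intro x y hx hy
    rw [expStein_of_ge ht hx, expStein_of_ge ht hy]
    exact (convex_Ici t).norm_image_sub_le_of_norm_hasDerivWithin_le
      (fun z hz => (hasDerivAt_const_div _ (ht.trans_le hz).ne').hasDerivWithinAt)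
      (fun z hz => abs_neg_one_sub_exp_neg_div_sq_le ht hz) hx hy
  have hcross : ∀ x y, x ≤ t → t ≤ y → |expStein t y - expStein t x| ≤ t⁻¹ * |y - x| := by
    intro x y hx hy
    have h1 := hleft x t hx le_rfl
    have h2 := hright t y le_rfl hy
    rw [abs_of_nonneg (sub_nonneg.2 hx)] at h1
    rw [abs_of_nonneg (sub_nonneg.2 hy)] at h2
    rw [abs_of_nonneg (sub_nonneg.2 (hx.trans hy))]
    have h3 := abs_add_le (expStein t y - expStein t t) (expStein t t - expStein t x)
    rw [sub_add_sub_cancel] at h3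
    linarith
  rcases le_total x t with hx | hx <;> rcases le_total y t with hy | hy
  · exact hleft x y hx hy
  · exact hcross x y hx hy
  · rw [abs_sub_comm, abs_sub_comm y x]
    exact hcross y x hy hx
  · exact hright x y hx hy

lemma continuous_expStein {t : ℝ} (ht : 0 < t) : Continuous (expStein t) :=
  (LipschitzWith.of_dist_le_mul (K := ⟨t⁻¹, (inv_pos.2 ht).le⟩)
    fun x y => abs_expStein_sub_le ht y x).continuous

lemma abs_expSteinDeriv_sub_le {t x y : ℝ} (ht : 0 < t)
    (h : x < t ∧ y < t ∨ t < x ∧ t < y) :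
    |expSteinDeriv t y - expSteinDeriv t x| ≤ max t⁻¹ (2 / t ^ 2) * |y - x| := by
  rcases h with ⟨hx, hy⟩ | ⟨hx, hy⟩
  · rw [expSteinDeriv, expSteinDeriv, if_pos hx.le, if_pos hy.le]
    exact (convex_Iio t).norm_image_sub_le_of_norm_hasDerivWithin_le
      (fun z _ => ((hasDerivAt_expMoment 1 z).const_mul (exp (-t))).hasDerivWithinAt)
      (fun z hz => (abs_exp_neg_mul_expMoment_le 2 ht (le_of_lt hz)).trans (le_max_left _ _))
      hx hy
  · rw [expSteinDeriv, expSteinDeriv, if_neg hx.not_ge, if_neg hy.not_ge]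
    refine (convex_Ioi t).norm_image_sub_le_of_norm_hasDerivWithin_le
      (fun z hz => (hasDerivAt_const_div_sq _ (ht.trans hz).ne').hasDerivWithinAt)
      (fun z hz => le_trans ?_ (le_max_right _ _)) hx hy
    obtain ⟨hp0, -, hpt⟩ := one_sub_exp_neg_mem ht
    have hz : t < z := hz
    have hz0 : 0 < z := ht.trans hz
    rw [norm_of_nonneg (by positivity)]
    calc 2 * (1 - exp (-t)) / z ^ 3 ≤ 2 * t / t ^ 3 := by gcongr
      _ = 2 / t ^ 2 := by field_simp

/-- If `|h'| ≤ C s ^ k` on `[0, 1]`, then `|h s - h 0| ≤ C s ^ (k + 1) / (k + 1)` there. -/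
lemma abs_sub_le_of_abs_deriv_le_pow {h h' : ℝ → ℝ} {C : ℝ} (k : ℕ)
    (hd : ∀ s ∈ Set.Icc (0 : ℝ) 1, HasDerivAt h (h' s) s)
    (hb : ∀ s ∈ Set.Icc (0 : ℝ) 1, |h' s| ≤ C * s ^ k) {s : ℝ} (hs : s ∈ Set.Icc (0 : ℝ) 1) :
    |h s - h 0| ≤ C / (k + 1) * s ^ (k + 1) := by
  refine image_norm_le_of_norm_deriv_right_le_deriv_boundary (f := fun s => h s - h 0)
    (f' := h') (B := fun s => C / (k + 1) * s ^ (k + 1)) (B' := fun s => C * s ^ k)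
    (fun s hs => ((hd s hs).sub_const _).continuousAt.continuousWithinAt)
    (fun s hs => ((hd s ⟨hs.1, hs.2.le⟩).sub_const _).hasDerivWithinAt) (by simp)
    (fun s => ?_) (fun s hs => hb s ⟨hs.1, hs.2.le⟩) hs
  refine ((hasDerivAt_pow (k + 1) s).const_mul (C / (k + 1))).congr_deriv ?_
  push_cast
  have : (k : ℝ) + 1 ≠ 0 := by positivity
  field_simp

/-- Second order Taylor remainder bound for `F`, with an arbitrary number `a` in place of the second
derivative. -/
lemma abs_taylor_two_le {F f : ℝ → ℝ} (hF : ∀ x, HasDerivAt F (f x) x) {w d a C : ℝ} (k : ℕ)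
    (hb : ∀ s ∈ Set.Icc (0 : ℝ) 1, |f (w + s * d) - f w - s * d * a| ≤ C * s ^ k) :
    |F (w + d) - F w - d * f w - d ^ 2 / 2 * a| ≤ |d| * C / (k + 1) := by
  have h := abs_sub_le_of_abs_deriv_le_pow (C := |d| * C)
    (h := fun s => F (w + s * d) - s * d * f w - s ^ 2 * d ^ 2 / 2 * a)
    (h' := fun s => d * (f (w + s * d) - f w - s * d * a)) k
    (fun s _ => ?_) (fun s hs => ?_) (Set.right_mem_Icc.2 zero_le_one)
  · simp only [one_mul, one_pow, zero_mul, add_zero, mul_one, sub_zero] at h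
    convert h using 2
    ring
  · have h1 : HasDerivAt (fun s : ℝ => w + s * d) d s := by
      simpa using ((hasDerivAt_id s).mul_const d).const_add w
    have h2 : HasDerivAt (fun s : ℝ => s * d * f w) (d * f w) s := by
      simpa using ((hasDerivAt_id s).mul_const d).mul_const (f w)
    have h3 : HasDerivAt (fun s : ℝ => s ^ 2 * d ^ 2 / 2 * a) (s * d ^ 2 * a) s := by
      refine ((((hasDerivAt_pow 2 s).mul_const (d ^ 2)).div_const 2).mul_const a).congr_deriv ?_
      push_cast
      ring
    refine ((((hF (w + s * d)).comp s h1).sub h2).sub h3).congr_deriv ?_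
    ring
  · rw [abs_mul, mul_assoc |d|]
    exact mul_le_mul_of_nonneg_left (hb s hs) (abs_nonneg d)

/-- Second order Taylor remainder bound for an antiderivative of the Stein solution. -/
lemma abs_expStein_remainder_le {F : ℝ → ℝ} {t w d : ℝ} (ht : 0 < t)
    (hF : ∀ x, HasDerivAt F (expStein t x) x) :
    |F (w + d) - F w - d * expStein t w - d ^ 2 / 2 * expSteinDeriv t w|
      ≤ |d| ^ 3 * max t⁻¹ (2 / t ^ 2) / 6 + d ^ 2 * (if |w - t| ≤ |d| then 1 else 0) / t := by
  have hM : 0 < max t⁻¹ (2 / t ^ 2) := lt_max_of_lt_left (inv_pos.2 ht)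
  split_ifs with hw
  · have h := abs_taylor_two_le hF (w := w) (d := d) (a := expSteinDeriv t w)
      (C := 2 * t⁻¹ * |d|) 1 fun s hs => ?_
    · have h3 : |d| * (2 * t⁻¹ * |d|) / ((1 : ℕ) + 1) = d ^ 2 * 1 / t := by
        rw [← sq_abs d]
        push_cast
        field_simp
        norm_num
      rw [h3] at h
      have : 0 ≤ |d| ^ 3 * max t⁻¹ (2 / t ^ 2) / 6 := by positivity
      linarith
    · have h1 := abs_expStein_sub_le ht w (w + s * d)
      rw [add_sub_cancel_left, abs_mul, abs_of_nonneg hs.1] at h1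
      have h2 : |s * d * expSteinDeriv t w| ≤ s * |d| * t⁻¹ := by
        rw [abs_mul, abs_mul, abs_of_nonneg hs.1]
        have := hs.1
        gcongr
        exact abs_expSteinDeriv_le ht w
      have h3 := abs_sub (expStein t (w + s * d) - expStein t w) (s * d * expSteinDeriv t w)
      linarith
  · have hside : ∀ s ∈ Set.Icc (0 : ℝ) 1,
        w < t ∧ w + s * d < t ∨ t < w ∧ t < w + s * d := by
      intro s hs
      have h1 : |s * d| ≤ |d| := by
        rw [abs_mul, abs_of_nonneg hs.1]
        exact mul_le_of_le_one_left (abs_nonneg d) hs.2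
      have h2 := abs_le.1 (h1.trans (not_le.1 hw).le)
      have h4 := abs_lt.1 (h1.trans_lt (not_le.1 hw))
      have h5 := (abs_nonneg d).trans_lt (not_le.1 hw)
      rcases lt_or_gt_of_ne (sub_ne_zero.1 (abs_pos.1 h5)) with h | h
      · rw [abs_of_neg (sub_neg.2 h)] at h4
        exact .inl ⟨h, by linarith⟩
      · rw [abs_of_pos (sub_pos.2 h)] at h4
        exact .inr ⟨h, by linarith⟩
    have h := abs_taylor_two_le hF (w := w) (d := d) (a := expSteinDeriv t w)
      (C := |d| ^ 2 * max t⁻¹ (2 / t ^ 2) / 2) 2 fun s hs => ?_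
    · convert h using 1
      push_cast
      ring
    · have h := abs_sub_le_of_abs_deriv_le_pow (C := |d| ^ 2 * max t⁻¹ (2 / t ^ 2))
        (h := fun s => expStein t (w + s * d) - s * d * expSteinDeriv t w)
        (h' := fun s => d * (expSteinDeriv t (w + s * d) - expSteinDeriv t w)) 1
        (fun s hs => ?_) (fun s hs => ?_) hs
      · simp only [zero_mul, add_zero, sub_zero] at h
        convert h using 1
        · congr 1
          ring
        · push_cast
          ring
      · have h1 : HasDerivAt (fun s : ℝ => w + s * d) d s := by
          simpa using ((hasDerivAt_id s).mul_const d).const_add w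
        have h2 : HasDerivAt (fun s : ℝ => s * d * expSteinDeriv t w)
            (d * expSteinDeriv t w) s := by
          simpa using ((hasDerivAt_id s).mul_const d).mul_const (expSteinDeriv t w)
        have hne : w + s * d ≠ t := by
          rcases hside s hs with h | h
          · exact h.2.ne
          · exact h.2.ne'
        refine (((hasDerivAt_expStein ht hne).comp s h1).sub h2).congr_deriv ?_
        ring
      · have h1 := abs_expSteinDeriv_sub_le ht (hside s hs)
        rw [add_sub_cancel_left, abs_mul, abs_of_nonneg hs.1] at h1
        rw [abs_mul]
        calc _ ≤ |d| * (max t⁻¹ (2 / t ^ 2) * (s * |d|)) := by gcongr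
          _ = _ := by ring

lemma integral_comp_mul_condExp {Ω : Type*} [MeasurableSpace Ω] {μ : Measure Ω}
    [IsProbabilityMeasure μ] {W Y : Ω → ℝ} (hW : Measurable W) (hY : Integrable Y μ)
    {g : ℝ → ℝ} (hg : Measurable g) {C : ℝ} (hC : ∀ x, |g x| ≤ C) :
    ∫ ω, g (W ω) * (μ[Y | MeasurableSpace.comap W inferInstance]) ω ∂μ
      = ∫ ω, g (W ω) * Y ω ∂μ := by
  have hgW : Measurable[MeasurableSpace.comap W inferInstance] (fun ω => g (W ω)) :=
    hg.comp (comap_measurable W)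
  have h := condExp_stronglyMeasurable_mul_of_bound hW.comap_le hgW.stronglyMeasurable hY C
    (.of_forall fun ω => hC (W ω))
  calc _ = ∫ ω, (μ[(fun ω => g (W ω)) * Y | MeasurableSpace.comap W inferInstance]) ω ∂μ :=
        (integral_congr_ae h).symm
    _ = _ := integral_condExp hW.comap_le

/-- Theorem 1.2 (basicexp): Berry-Esséen bound for the exponential law, version 2. -/
theorem exponential_berry_esseen_v2
    {Ω : Type*} [MeasurableSpace Ω] {μ : Measure Ω} [IsProbabilityMeasure μ]
    (W W' : Ω → ℝ) (hW : Measurable W) (hW' : Measurable W')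
    (hWnn : ∀ ω, 0 ≤ W ω) (hW'nn : ∀ ω, 0 ≤ W' ω)
    (hdist : μ.map W = μ.map W')
    (lam : ℝ) (hlam : 0 < lam)
    (D : Ω → ℝ) (hDdef : D = fun ω => W' ω - W ω)
    (hD1 : Integrable D μ)
    (hD2 : Integrable (fun ω => (D ω) ^ 2) μ)
    (hD3 : Integrable (fun ω => |D ω| ^ 3) μ)
    (hcond : μ[D | MeasurableSpace.comap W inferInstance] =ᵐ[μ] fun ω => -lam * (W ω - 1))
    (t : ℝ) (ht : 0 < t) :
    |(μ {ω | W ω ≤ t}).toReal - (1 - Real.exp (-t))| ≤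
      (∫ ω, |2 * lam * W ω -
          (μ[(fun ω' => (D ω') ^ 2) | MeasurableSpace.comap W inferInstance]) ω| ∂μ)
        / (2 * lam * t)
      + (∫ ω, |D ω| ^ 3 ∂μ) * max t⁻¹ (2 / t ^ 2) / (6 * lam)
      + (∫ ω, (D ω) ^ 2 * Set.indicator {ω' | |W ω' - t| ≤ |D ω'|} (fun _ => (1 : ℝ)) ω ∂μ)
        / (lam * t) := by
  set M := max t⁻¹ (2 / t ^ 2)
  set V := μ[(fun ω' => (D ω') ^ 2) | MeasurableSpace.comap W inferInstance]
  set I := Set.indicator {ω' | |W ω' - t| ≤ |D ω'|} (fun _ => (1 : ℝ))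
  have hDm : Measurable D := hDdef ▸ hW'.sub hW
  have hV : Integrable V μ := integrable_condExp
  have hf : Measurable (expStein t) := (continuous_expStein ht).measurable
  have hφ : Measurable (expSteinDeriv t) := measurable_expSteinDeriv t
  have hW1 : Integrable (fun ω => W ω - 1) μ := by
    have h := ((integrable_congr hcond).1 integrable_condExp).const_mul (-lam)⁻¹
    refine h.congr (.of_forall fun ω => ?_)
    field_simp
  have hWint : Integrable W μ := by
    refine (hW1.add (integrable_const (1 : ℝ))).congr (.of_forall fun ω => ?_)
    simp
  have hfmul : ∀ {Y : Ω → ℝ}, Integrable Y μ → Integrable (fun ω => expStein t (W ω) * Y ω) μ :=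
    fun hY => hY.bdd_mul (hf.comp hW).aestronglyMeasurable
      (.of_forall fun ω => abs_expStein_le ht (W ω))
  have hφmul : ∀ {Y : Ω → ℝ}, Integrable Y μ →
      Integrable (fun ω => expSteinDeriv t (W ω) * Y ω) μ :=
    fun hY => hY.bdd_mul (hφ.comp hW).aestronglyMeasurable
      (.of_forall fun ω => abs_expSteinDeriv_le ht (W ω))
  have hD2I : Integrable (fun ω => D ω ^ 2 * I ω) μ := by
    refine (hD2.indicator (s := {ω' | |W ω' - t| ≤ |D ω'|})
      (measurableSet_le (hW.sub_const t).abs hDm.abs)).congr (.of_forall fun ω => ?_)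
    simp [I, Set.indicator_apply]
  -- the antiderivative of the Stein solution
  set F : ℝ → ℝ := fun x => ∫ y in (0 : ℝ)..x, expStein t y
  have hF : ∀ x, HasDerivAt F (expStein t x) x := fun x =>
    ((continuous_expStein ht).integral_hasStrictDerivAt 0 x).hasDerivAt
  have hFc : Continuous F := continuous_iff_continuousAt.2 fun x => (hF x).continuousAt
  have hFle : ∀ x, |F x| ≤ t⁻¹ * |x| := fun x => by
    simpa using intervalIntegral.norm_integral_le_of_norm_le_const (a := 0) (b := x)
      (f := expStein t) (C := t⁻¹) fun y _ => abs_expStein_le ht y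
  have hFint : ∀ {X : Ω → ℝ}, Measurable X → Integrable X μ → Integrable (fun ω => F (X ω)) μ :=
    fun hX hXi => (hXi.abs.const_mul t⁻¹).mono' (hFc.measurable.comp hX).aestronglyMeasurable
      (.of_forall fun ω => hFle _)
  have hW'int : Integrable W' μ := by
    refine (hD1.add hWint).congr (.of_forall fun ω => ?_)
    simp [hDdef]
  have hFeq : ∫ ω, F (W' ω) ∂μ = ∫ ω, F (W ω) ∂μ := by
    rw [← integral_map hW.aemeasurable hFc.aestronglyMeasurable, hdist,
      integral_map hW'.aemeasurable hFc.aestronglyMeasurable]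
  -- the remainder of the second order Taylor expansion
  set R : Ω → ℝ := fun ω => F (W' ω) - F (W ω) - expStein t (W ω) * D ω
    - 1 / 2 * (expSteinDeriv t (W ω) * D ω ^ 2)
  have hRle : ∀ ω, |R ω| ≤ |D ω| ^ 3 * (M / 6) + D ω ^ 2 * I ω * t⁻¹ := fun ω => by
    have h := abs_expStein_remainder_le (w := W ω) (d := D ω) ht hF
    have hW'ω : W ω + D ω = W' ω := by simp [hDdef]
    rw [hW'ω] at h
    convert h using 1
    · congr 1
      ring
    · simp only [I, M, Set.indicator_apply, Set.mem_ofPred_eq]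
      ring
  have hbound : Integrable (fun ω => |D ω| ^ 3 * (M / 6) + D ω ^ 2 * I ω * t⁻¹) μ :=
    (hD3.mul_const _).add (hD2I.mul_const _)
  have hRint : |∫ ω, R ω ∂μ| ≤ (∫ ω, |D ω| ^ 3 ∂μ) * (M / 6) + (∫ ω, D ω ^ 2 * I ω ∂μ) * t⁻¹ := by
    have h := norm_integral_le_of_norm_le (f := R) hbound (.of_forall hRle)
    rwa [integral_add (hD3.mul_const _) (hD2I.mul_const _), integral_mul_const,
      integral_mul_const] at h
  have hE1 : ∫ ω, expStein t (W ω) * D ω ∂μ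
      = -lam * ∫ ω, expStein t (W ω) * (W ω - 1) ∂μ := by
    rw [← integral_comp_mul_condExp hW hD1 hf (abs_expStein_le ht), ← integral_const_mul]
    refine integral_congr_ae ?_
    filter_upwards [hcond] with ω hω
    rw [hω]
    ring
  have hE2 : ∫ ω, expSteinDeriv t (W ω) * D ω ^ 2 ∂μ = ∫ ω, expSteinDeriv t (W ω) * V ω ∂μ :=
    (integral_comp_mul_condExp hW hD2 hφ (abs_expSteinDeriv_le ht)).symm
  have hR : ∫ ω, R ω ∂μ = lam * ∫ ω, expStein t (W ω) * (W ω - 1) ∂μ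
      - 1 / 2 * ∫ ω, expSteinDeriv t (W ω) * V ω ∂μ := by
    have hi : Integrable (fun ω => F (W' ω) - F (W ω)) μ :=
      (hFint hW' hW'int).sub (hFint hW hWint)
    have hi2 : Integrable (fun ω => F (W' ω) - F (W ω) - expStein t (W ω) * D ω) μ :=
      hi.sub (hfmul hD1)
    rw [integral_sub hi2 ((hφmul hD2).const_mul _),
      integral_sub hi (hfmul hD1), integral_sub (hFint hW' hW'int) (hFint hW hWint), hFeq,
      integral_const_mul, hE1, hE2]
    ring
  have hmain : (μ {ω | W ω ≤ t}).toReal - (1 - exp (-t))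
      = ∫ ω, expSteinDeriv t (W ω) * W ω ∂μ - ∫ ω, expStein t (W ω) * (W ω - 1) ∂μ := by
    have hs : MeasurableSet {ω | W ω ≤ t} := measurableSet_le hW measurable_const
    rw [← integral_sub (hφmul hWint) (hfmul hW1)]
    calc _ = ∫ ω, ({ω | W ω ≤ t}.indicator (fun _ => (1 : ℝ)) ω - (1 - exp (-t))) ∂μ := by
          rw [integral_sub ((integrable_const _).indicator hs) (integrable_const _),
            integral_indicator hs]
          simp [measureReal_def]
      _ = _ := by
          refine integral_congr_ae (.of_forall fun ω => ?_)
          have h := mul_expSteinDeriv_sub (x := W ω) ht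
          simp only [Set.indicator_apply, Set.mem_ofPred_eq]
          rw [← h]
          ring
  have hsplit : ∫ ω, expSteinDeriv t (W ω) * (2 * lam * W ω - V ω) ∂μ
      = 2 * lam * ∫ ω, expSteinDeriv t (W ω) * W ω ∂μ - ∫ ω, expSteinDeriv t (W ω) * V ω ∂μ := by
    rw [← integral_const_mul, ← integral_sub ((hφmul hWint).const_mul _) (hφmul hV)]
    congr 1 with ω
    ring
  have hfirst : |∫ ω, expSteinDeriv t (W ω) * (2 * lam * W ω - V ω) ∂μ|
      ≤ t⁻¹ * ∫ ω, |2 * lam * W ω - V ω| ∂μ := by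
    rw [← integral_const_mul]
    have hi : Integrable (fun ω => t⁻¹ * |2 * lam * W ω - V ω|) μ :=
      ((hWint.const_mul _).sub hV).abs.const_mul _
    rw [← norm_eq_abs]
    refine norm_integral_le_of_norm_le hi (.of_forall fun ω => ?_)
    rw [norm_mul]
    exact mul_le_mul_of_nonneg_right (abs_expSteinDeriv_le ht _) (norm_nonneg _)
  have hkey : (μ {ω | W ω ≤ t}).toReal - (1 - exp (-t))
      = (∫ ω, expSteinDeriv t (W ω) * (2 * lam * W ω - V ω) ∂μ) / (2 * lam)
        - (∫ ω, R ω ∂μ) / lam := by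
    rw [hmain, hsplit, hR]
    field_simp
    ring
  rw [hkey]
  refine (abs_sub _ _).trans ?_
  rw [abs_div, abs_div, abs_of_pos hlam, abs_of_pos (by positivity : 0 < 2 * lam)]
  calc _ ≤ (t⁻¹ * ∫ ω, |2 * lam * W ω - V ω| ∂μ) / (2 * lam)
        + ((∫ ω, |D ω| ^ 3 ∂μ) * (M / 6) + (∫ ω, D ω ^ 2 * I ω ∂μ) * t⁻¹) / lam := by gcongr
    _ = _ := by
        field_simp
        ring
end

section
/- For each even n, let W_n be the random variable which takes the value W(i) := (n − 2i)(n + 2 − 2i)/(2n) with probability π(i), where π(i) = (C(n,i) − C(n,i−1))/C(n, n/2) for 1 ≤ i ≤ n/2 and π(0) = 1/C(n, n/2). Then as n → ∞ through even values, W_n converges in distribution to an exponential random variable with mean 1; that is, for every t ≥ 0, P(W_n ≤ t) → 1 − e^{−t}. -/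
open Finset Filter

/-- The probability that the spectral measure puts on eigenvalue index `i`. -/
noncomputable def piBL (n i : ℕ) : ℝ :=
  if i = 0 then 1 / (n.choose (n / 2) : ℝ)
  else ((n.choose i : ℝ) - (n.choose (i - 1) : ℝ)) / (n.choose (n / 2) : ℝ)

/-- The rescaled eigenvalue `W(i) = (n-2i)(n+2-2i)/(2n)`. -/
noncomputable def WBL (n i : ℕ) : ℝ :=
  ((n : ℝ) - 2 * i) * ((n : ℝ) + 2 - 2 * i) / (2 * n)

/-- `P(W_n ≤ t)` for the rescaled spectral measure of the Bernoulli-Laplace chain. -/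
noncomputable def PBL (n : ℕ) (t : ℝ) : ℝ :=
  ∑ i ∈ Finset.range (n / 2 + 1), if WBL n i ≤ t then piBL n i else 0

/-- The mass of the indices in `(a, N]` telescopes. -/
theorem sum_piBL_of_lt (n a N : ℕ) (h : a ≤ N) :
    (∑ i ∈ Finset.range (N + 1), if a < i then piBL n i else 0) =
      ((n.choose N : ℝ) - n.choose a) / n.choose (n / 2) := by
  induction N, h using Nat.le_induction with
  | base =>
    rw [sub_self, zero_div]
    refine Finset.sum_eq_zero fun i hi => if_neg ?_
    have := Finset.mem_range.1 hi
    omega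
  | succ N hN ih =>
    rw [Finset.sum_range_succ, ih, if_pos (by omega), piBL, if_neg (by omega),
      Nat.add_sub_cancel]
    ring

theorem choose_two_mul_sub_succ (m l : ℕ) (h : l + 1 ≤ m) :
    ((2 * m).choose (m - (l + 1)) : ℝ) * (m + l + 1) = (2 * m).choose (m - l) * (m - l) := by
  have key := Nat.choose_succ_right_eq (2 * m) (m - (l + 1))
  rw [show m - (l + 1) + 1 = m - l by omega,
    show 2 * m - (m - (l + 1)) = m + l + 1 by omega] at key
  have key' : (((2 * m).choose (m - l) * (m - l) : ℕ) : ℝ) =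
      (((2 * m).choose (m - (l + 1)) * (m + l + 1) : ℕ) : ℝ) := by rw [key]
  push_cast [Nat.cast_sub (show l ≤ m by omega)] at key'
  exact key'.symm

theorem choose_two_mul_sub_le (m j l : ℕ) (hl : l ≤ j) (hj : j ≤ m) (hm : 0 < m) :
    ((2 * m).choose (m - l) : ℝ) ≤
      (2 * m).choose m * Real.exp (-((l : ℝ) ^ 2 / (m + j))) := by
  induction l with
  | zero => simp
  | succ l ih =>
    have ih := ih (by omega)
    have hrec := choose_two_mul_sub_succ m l (by omega)
    have hm' : (0 : ℝ) < m := by exact_mod_cast hm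
    have hlj : (l : ℝ) + 1 ≤ j := by exact_mod_cast hl
    have hlm : (l : ℝ) + 1 ≤ m := by exact_mod_cast hl.trans hj
    have hratio : ((m : ℝ) - l) / (m + l + 1) ≤ Real.exp (-((2 * l + 1) / (m + j))) := by
      have h1 : ((m : ℝ) - l) / (m + l + 1) = -((2 * l + 1) / (m + l + 1)) + 1 := by
        field_simp
        ring
      have h2 : ((2 * l + 1) / (m + j) : ℝ) ≤ (2 * l + 1) / (m + l + 1) := by
        exact div_le_div_of_nonneg_left (by positivity) (by positivity) (by linarith)
      rw [h1]
      refine le_trans ?_ (Real.add_one_le_exp _)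
      linarith
    calc ((2 * m).choose (m - (l + 1)) : ℝ)
        = (2 * m).choose (m - l) * (((m : ℝ) - l) / (m + l + 1)) := by
          rw [← mul_div_assoc, ← hrec]
          field_simp
      _ ≤ (2 * m).choose m * Real.exp (-((l : ℝ) ^ 2 / (m + j))) *
            Real.exp (-((2 * l + 1) / (m + j))) :=
          mul_le_mul ih hratio (div_nonneg (by linarith) (by positivity)) (by positivity)
      _ = (2 * m).choose m * Real.exp (-(((l + 1 : ℕ) : ℝ) ^ 2 / (m + j))) := by
          rw [mul_assoc, ← Real.exp_add]
          congr 2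
          push_cast
          ring

theorem le_choose_two_mul_sub (m j l : ℕ) (hl : l ≤ j) (hj : j ≤ m) :
    (2 * m).choose m * Real.exp (-((l : ℝ) ^ 2 / (m + 1 - j))) ≤
      ((2 * m).choose (m - l) : ℝ) := by
  induction l with
  | zero => simp
  | succ l ih =>
    have ih := ih (by omega)
    have hrec := choose_two_mul_sub_succ m l (by omega)
    have hlj : (l : ℝ) + 1 ≤ j := by exact_mod_cast hl
    have hjm : (j : ℝ) ≤ m := by exact_mod_cast hj
    have hpos : (0 : ℝ) < m - l := by linarith
    have hratio : Real.exp (-((2 * l + 1) / (m + 1 - j))) ≤ ((m : ℝ) - l) / (m + l + 1) := by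
      have h1 : ((m : ℝ) + l + 1) / (m - l) = (2 * l + 1) / (m - l) + 1 := by
        field_simp
        ring
      have h2 : ((2 * l + 1) / (m - l) : ℝ) ≤ (2 * l + 1) / (m + 1 - j) := by
        exact div_le_div_of_nonneg_left (by positivity) (by linarith) (by linarith)
      rw [Real.exp_neg, ← inv_div ((m : ℝ) + l + 1)]
      refine inv_anti₀ (by positivity) ?_
      rw [h1]
      exact le_trans (by linarith) (Real.add_one_le_exp _)
    calc (2 * m).choose m * Real.exp (-(((l + 1 : ℕ) : ℝ) ^ 2 / (m + 1 - j)))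
        = (2 * m).choose m * Real.exp (-((l : ℝ) ^ 2 / (m + 1 - j))) *
            Real.exp (-((2 * l + 1) / (m + 1 - j))) := by
          rw [mul_assoc, ← Real.exp_add]
          congr 2
          push_cast
          ring
      _ ≤ (2 * m).choose (m - l) * (((m : ℝ) - l) / (m + l + 1)) :=
          mul_le_mul ih hratio (by positivity) (by positivity)
      _ = ((2 * m).choose (m - (l + 1)) : ℝ) := by
          rw [← mul_div_assoc, ← hrec]
          field_simp

/-- The number of `k : ℕ` with `k * (k + 1) ≤ t * m`. -/
noncomputable def thresholdBL (t : ℝ) (m : ℕ) : ℕ := ⌊√(t * m + 1 / 4) + 1 / 2⌋₊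

theorem WBL_le_iff {t : ℝ} (ht : 0 ≤ t) {m i : ℕ} (hm : 0 < m) (hi : i ≤ m) :
    WBL (2 * m) i ≤ t ↔ m - i < thresholdBL t m := by
  obtain ⟨k, rfl⟩ := Nat.exists_eq_add_of_le hi
  have hm' : (0 : ℝ) < (i + k : ℕ) := by exact_mod_cast hm
  have hW : WBL (2 * (i + k)) i = k * (k + 1) / (i + k : ℕ) := by
    rw [WBL]
    push_cast at hm' ⊢
    field_simp
    ring
  rw [hW, div_le_iff₀ hm', Nat.add_sub_cancel_left, ← Nat.succ_le_iff, thresholdBL,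
    Nat.le_floor_iff (by positivity), Nat.cast_succ,
    show (k : ℝ) + 1 ≤ √(t * (i + k : ℕ) + 1 / 4) + 1 / 2 ↔
      (k : ℝ) + 1 / 2 ≤ √(t * (i + k : ℕ) + 1 / 4) by constructor <;> intro h <;> linarith,
    Real.le_sqrt' (by positivity)]
  constructor <;> intro h <;> nlinarith

theorem PBL_two_mul {t : ℝ} (ht : 0 ≤ t) {m : ℕ} (hm : 0 < m) (hj : thresholdBL t m ≤ m) :
    PBL (2 * m) t = 1 - ((2 * m).choose (m - thresholdBL t m) : ℝ) / (2 * m).choose m := by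
  have hC : ((2 * m).choose m : ℝ) ≠ 0 := by
    exact_mod_cast (Nat.choose_pos (by omega)).ne'
  have h2 : 2 * m / 2 = m := by omega
  have hsum := sum_piBL_of_lt (2 * m) (m - thresholdBL t m) m (Nat.sub_le _ _)
  rw [h2, sub_div, div_self hC] at hsum
  rw [PBL, h2, ← hsum]
  refine Finset.sum_congr rfl fun i hi => ?_
  have him : i ≤ m := by
    have := Finset.mem_range.1 hi
    omega
  refine if_congr ((WBL_le_iff ht hm him).trans ?_) rfl rfl
  omega

theorem tendsto_thresholdBL_div_sqrt (t : ℝ) (ht : 0 ≤ t) :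
    Tendsto (fun m : ℕ => (thresholdBL t m : ℝ) / √m) atTop (nhds √t) := by
  have hinv : Tendsto (fun m : ℕ => (1 / 2 : ℝ) / √m) atTop (nhds 0) :=
    tendsto_const_nhds.div_atTop (Real.tendsto_sqrt_atTop.comp tendsto_natCast_atTop_atTop)
  have hmain : Tendsto (fun m : ℕ => √(t * m + 1 / 4) / √m) atTop (nhds √t) := by
    have h : Tendsto (fun m : ℕ => √(t + 1 / 4 / m)) atTop (nhds √(t + 0)) :=
      (tendsto_const_nhds.add
        (tendsto_const_nhds.div_atTop tendsto_natCast_atTop_atTop)).sqrt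
    rw [add_zero] at h
    refine h.congr' ?_
    filter_upwards [eventually_gt_atTop 0] with m hm
    have hm' : (0 : ℝ) < m := by exact_mod_cast hm
    rw [← Real.sqrt_div (by positivity)]
    congr 1
    field_simp
  have hlow := hmain.sub hinv
  have hupp := hmain.add hinv
  rw [sub_zero] at hlow
  rw [add_zero] at hupp
  refine tendsto_of_tendsto_of_tendsto_of_le_of_le hlow hupp (fun m => ?_) (fun m => ?_)
  · change √(t * m + 1 / 4) / √m - 1 / 2 / √m ≤ _
    rw [← sub_div]
    refine div_le_div_of_nonneg_right ?_ (Real.sqrt_nonneg _)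
    have := Nat.lt_floor_add_one (√(t * m + 1 / 4) + 1 / 2)
    rw [thresholdBL]
    linarith
  · change _ ≤ √(t * m + 1 / 4) / √m + 1 / 2 / √m
    rw [← add_div]
    exact div_le_div_of_nonneg_right (Nat.floor_le (by positivity)) (Real.sqrt_nonneg _)

/-- Theorem 1.3 (Hora): as `n → ∞` through even values, `W_n` converges in distribution
to an exponential random variable with mean 1. -/
theorem bernoulli_laplace_spectrum_exponential_limit :
    ∀ t : ℝ, 0 ≤ t →
      Tendsto (fun m : ℕ => PBL (2 * m) t) atTop (nhds (1 - Real.exp (-t))) := by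
  intro t ht
  set j : ℕ → ℕ := thresholdBL t
  have hsqrt := tendsto_thresholdBL_div_sqrt t ht
  have hsq : Tendsto (fun m : ℕ => (j m : ℝ) ^ 2 / m) atTop (nhds t) := by
    have h := hsqrt.pow 2
    rw [Real.sq_sqrt ht] at h
    refine h.congr fun m => ?_
    rw [div_pow, Real.sq_sqrt (Nat.cast_nonneg m)]
  have hinv : Tendsto (fun m : ℕ => 1 / (m : ℝ)) atTop (nhds 0) :=
    tendsto_const_nhds.div_atTop tendsto_natCast_atTop_atTop
  have hdiv : Tendsto (fun m : ℕ => (j m : ℝ) / m) atTop (nhds 0) := by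
    have h := hsqrt.div_atTop (Real.tendsto_sqrt_atTop.comp tendsto_natCast_atTop_atTop)
    refine h.congr fun m => ?_
    rw [Function.comp_apply, div_div, Real.mul_self_sqrt (Nat.cast_nonneg m)]
  have hle : ∀ᶠ m : ℕ in atTop, 0 < m ∧ j m ≤ m := by
    filter_upwards [eventually_gt_atTop 0, hdiv.eventually (gt_mem_nhds one_pos)] with m hm h
    have hm' : (0 : ℝ) < m := by exact_mod_cast hm
    rw [div_lt_one hm'] at h
    exact ⟨hm, by exact_mod_cast h.le⟩
  have hupp : Tendsto (fun m : ℕ => Real.exp (-((j m : ℝ) ^ 2 / (m + j m)))) atTop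
      (nhds (Real.exp (-t))) := by
    have h := hsq.div (hdiv.const_add 1) (by norm_num)
    rw [add_zero, div_one] at h
    refine (Real.continuous_exp.tendsto _).comp (Tendsto.neg (h.congr' ?_))
    filter_upwards [hle] with m hm
    have hm' : (0 : ℝ) < m := by exact_mod_cast hm.1
    simp only [Pi.div_apply]
    field_simp
  have hlow : Tendsto (fun m : ℕ => Real.exp (-((j m : ℝ) ^ 2 / (m + 1 - j m)))) atTop
      (nhds (Real.exp (-t))) := by
    have h := hsq.div ((hinv.const_add 1).sub hdiv) (by norm_num)
    rw [add_zero, sub_zero, div_one] at h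
    refine (Real.continuous_exp.tendsto _).comp (Tendsto.neg (h.congr' ?_))
    filter_upwards [hle] with m hm
    have hm' : (0 : ℝ) < m := by exact_mod_cast hm.1
    simp only [Pi.div_apply]
    have h1 : 1 + 1 / (m : ℝ) - j m / m = (m + 1 - j m) / m := by field_simp
    rw [h1, div_div_div_cancel_right₀ hm'.ne']
  have hC : ∀ m : ℕ, (0 : ℝ) < (2 * m).choose m := fun m => by
    exact_mod_cast Nat.choose_pos (by omega)
  have hratio : Tendsto (fun m : ℕ => ((2 * m).choose (m - j m) : ℝ) / (2 * m).choose m) atTop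
      (nhds (Real.exp (-t))) := by
    refine tendsto_of_tendsto_of_tendsto_of_le_of_le' hlow hupp ?_ ?_
    · filter_upwards [hle] with m hm
      rw [le_div_iff₀' (hC m)]
      exact le_choose_two_mul_sub m _ _ le_rfl hm.2
    · filter_upwards [hle] with m hm
      rw [div_le_iff₀' (hC m)]
      exact choose_two_mul_sub_le m _ _ le_rfl hm.2 hm.1
  refine (hratio.const_sub 1).congr' ?_
  filter_upwards [hle] with m hm
  exact (PBL_two_mul ht hm.1 hm.2).symm
end

section
/- There is a universal constant C such that for every even n ≥ 2 and every t > 0, |P(W_n ≤ t) − P(Z ≤ t)| ≤ C/√n, where W_n takes the value W(i) := (n − 2i)(n + 2 − 2i)/(2n) with probability π(i), π(i) = (C(n,i) − C(n,i−1))/C(n, n/2) for 1 ≤ i ≤ n/2, π(0) = 1/C(n, n/2), and Z ~ Exp(1). -/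
open Finset Filter

/-- The central binomial ratio `C(2m, m-k) / C(2m, m)`. -/
noncomputable def centralRatio (m k : ℕ) : ℝ :=
  ((2 * m).choose (m - k) : ℝ) / ((2 * m).choose m : ℝ)

lemma choose_two_mul_self_pos (m : ℕ) : (0 : ℝ) < ((2 * m).choose m : ℝ) := by
  exact_mod_cast Nat.choose_pos (by omega)

lemma centralRatio_zero (m : ℕ) : centralRatio m 0 = 1 := by
  simpa [centralRatio] using div_self (choose_two_mul_self_pos m).ne'

lemma centralRatio_succ {m k : ℕ} (hk : k < m) :
    centralRatio m (k + 1) = centralRatio m k * (((m : ℝ) - k) / (m + k + 1)) := by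
  obtain ⟨d, rfl⟩ := Nat.exists_eq_add_of_lt hk
  have h := Nat.choose_succ_right_eq (2 * (k + d + 1)) d
  rw [show 2 * (k + d + 1) - d = 2 * k + d + 2 by omega] at h
  have h' : ((2 * (k + d + 1)).choose (d + 1) : ℝ) * (d + 1) =
      ((2 * (k + d + 1)).choose d : ℝ) * (2 * k + d + 2) := by exact_mod_cast h
  have h0 := choose_two_mul_self_pos (k + d + 1)
  unfold centralRatio
  rw [show k + d + 1 - (k + 1) = d by omega, show k + d + 1 - k = d + 1 by omega]
  push_cast
  have hp : (0 : ℝ) < k + d + 1 + k + 1 := by positivity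
  rw [div_mul_div_comm, div_eq_div_iff h0.ne' (mul_pos h0 hp).ne']
  linear_combination -((2 * (k + d + 1)).choose (k + d + 1) : ℝ) * h'

lemma centralRatio_nonneg (m k : ℕ) : 0 ≤ centralRatio m k := by
  unfold centralRatio; positivity

lemma one_sub_div_one_add_le_exp {x : ℝ} (h0 : 0 ≤ x) (h1 : x < 1) :
    (1 - x) / (1 + x) ≤ Real.exp (-(2 * x)) := by
  have h := Real.sum_range_le_log_div h0 h1 1
  simp only [sum_range_one] at h
  have hpos : 0 < (1 + x) / (1 - x) := div_pos (by linarith) (by linarith)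
  have h2 : Real.exp (2 * x) ≤ (1 + x) / (1 - x) := by
    rw [← Real.le_log_iff_exp_le hpos]
    norm_num at h
    linarith
  rw [Real.exp_neg, ← inv_div]
  exact inv_anti₀ (Real.exp_pos _) h2

lemma exp_le_one_sub_div_one_add {x : ℝ} (h0 : 0 ≤ x) (h1 : x ≤ 1 / 2) :
    Real.exp (-(2 * x + 4 * x ^ 3)) ≤ (1 - x) / (1 + x) := by
  have hx3 : 0 ≤ x ^ 3 := by positivity
  have h2 : (1 + x) / (1 - x) ≤ Real.exp (2 * x + 4 * x ^ 3) := by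
    refine le_trans ?_ (Real.quadratic_le_exp_of_nonneg (by positivity))
    rw [div_le_iff₀ (by linarith)]
    have h4 : (2 * x) ^ 2 ≤ (2 * x + 4 * x ^ 3) ^ 2 :=
      pow_le_pow_left₀ (by positivity) (by linarith) 2
    have : (1 + 2 * x + 4 * x ^ 3 + 2 * x ^ 2) * (1 - x) - (1 + x) = 2 * x ^ 3 * (1 - 2 * x) := by
      ring
    nlinarith [mul_nonneg hx3 (sub_nonneg.2 (by linarith : 2 * x ≤ 1)),
      mul_nonneg (sub_nonneg.2 h4) (by linarith : 0 ≤ 1 - x)]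
  rw [Real.exp_neg, ← inv_div]
  exact inv_anti₀ (div_pos (by linarith) (by linarith)) h2

lemma ratio_eq_one_sub_div_one_add (m k : ℕ) :
    ((m : ℝ) - k) / (m + k + 1) =
      (1 - ((k : ℝ) + 1 / 2) / (m + 1 / 2)) / (1 + ((k : ℝ) + 1 / 2) / (m + 1 / 2)) := by
  have h1 : (m : ℝ) + 1 / 2 ≠ 0 := by positivity
  have h2 : (m : ℝ) + k + 1 ≠ 0 := by positivity
  have h3 : 1 + ((k : ℝ) + 1 / 2) / (m + 1 / 2) ≠ 0 := by positivity
  rw [div_eq_div_iff h2 h3]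
  field_simp
  ring

lemma centralRatio_le_exp {m k : ℕ} (hk : k ≤ m) :
    centralRatio m k ≤ Real.exp (-((k : ℝ) ^ 2 / (m + 1 / 2))) := by
  induction k with
  | zero => simp [centralRatio_zero]
  | succ k ih =>
    have hkm : (k : ℝ) < m := by exact_mod_cast hk
    rw [centralRatio_succ hk, ratio_eq_one_sub_div_one_add]
    set x : ℝ := ((k : ℝ) + 1 / 2) / (m + 1 / 2) with hx
    have hx0 : 0 ≤ x := by positivity
    have hx1 : x < 1 := by rw [hx, div_lt_one (by positivity)]; linarith
    calc _ ≤ Real.exp (-((k : ℝ) ^ 2 / (m + 1 / 2))) * Real.exp (-(2 * x)) :=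
          mul_le_mul (ih (by omega)) (one_sub_div_one_add_le_exp hx0 hx1)
            (div_nonneg (by linarith) (by linarith)) (Real.exp_pos _).le
      _ = _ := by
          rw [← Real.exp_add]
          congr 1
          rw [hx]
          push_cast
          ring

lemma exp_le_centralRatio {m k : ℕ} (hk : 2 * (k : ℝ) ≤ m + 1 / 2) :
    Real.exp (-((k : ℝ) ^ 2 / (m + 1 / 2) + 4 * (k : ℝ) ^ 4 / (m + 1 / 2) ^ 3)) ≤
      centralRatio m k := by
  induction k with
  | zero => simp [centralRatio_zero]
  | succ k ih =>
    push_cast at hk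
    have hkm : k < m := by
      have : (k : ℝ) < m := by linarith [(k.cast_nonneg : (0 : ℝ) ≤ k)]
      exact_mod_cast this
    rw [centralRatio_succ hkm, ratio_eq_one_sub_div_one_add]
    set x : ℝ := ((k : ℝ) + 1 / 2) / (m + 1 / 2) with hx
    have hx0 : 0 ≤ x := by positivity
    have hx1 : x ≤ 1 / 2 := by rw [hx, div_le_iff₀ (by positivity)]; linarith
    refine le_trans ?_ (mul_le_mul (ih (by linarith)) (exp_le_one_sub_div_one_add hx0 hx1)
      (Real.exp_pos _).le (centralRatio_nonneg _ _))
    rw [← Real.exp_add]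
    apply Real.exp_le_exp.2
    have hquartic : 4 * (k : ℝ) ^ 4 / (m + 1 / 2) ^ 3 + 4 * x ^ 3 ≤
        4 * ((k : ℝ) + 1) ^ 4 / (m + 1 / 2) ^ 3 := by
      rw [hx, div_pow, ← mul_div_assoc, ← add_div]
      gcongr
      have hk0 : (0 : ℝ) ≤ k := k.cast_nonneg
      nlinarith [pow_nonneg hk0 2, pow_nonneg hk0 3]
    have hsq : ((k : ℝ) + 1) ^ 2 / (m + 1 / 2) = (k : ℝ) ^ 2 / (m + 1 / 2) + 2 * x := by
      rw [hx]; ring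
    push_cast
    linarith

lemma exp_neg_sub_exp_neg_le (x y : ℝ) :
    Real.exp (-x) - Real.exp (-y) ≤ (y - x) * Real.exp (-x) := by
  have h : Real.exp (-y) = Real.exp (-x) * Real.exp (x - y) := by
    rw [← Real.exp_add]; ring_nf
  nlinarith [Real.add_one_le_exp (x - y), Real.exp_pos (-x)]

lemma abs_exp_neg_sub_exp_neg_le {x y l : ℝ} (hx : l ≤ x) (hy : l ≤ y) :
    |Real.exp (-x) - Real.exp (-y)| ≤ |x - y| * Real.exp (-l) := by
  have key : ∀ u v : ℝ, l ≤ u →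
      Real.exp (-u) - Real.exp (-v) ≤ |u - v| * Real.exp (-l) := by
    intro u v hu
    refine (exp_neg_sub_exp_neg_le u v).trans ?_
    refine mul_le_mul ?_ (Real.exp_le_exp.2 (by linarith)) (Real.exp_pos _).le (abs_nonneg _)
    rw [abs_sub_comm]
    exact le_abs_self _
  rw [abs_le]
  constructor
  · have := key y x hy
    rw [abs_sub_comm] at this
    linarith
  · exact key x y hx

lemma exp_neg_le_inv {a : ℝ} (ha : 0 < a) : Real.exp (-a) ≤ a⁻¹ := by
  rw [Real.exp_neg]
  exact inv_anti₀ ha (by linarith [Real.add_one_le_exp a])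

lemma sq_mul_exp_neg_le {a : ℝ} (ha : 0 ≤ a) : a ^ 2 * Real.exp (-a) ≤ 2 := by
  rw [Real.exp_neg, mul_inv_le_iff₀ (Real.exp_pos a)]
  linarith [Real.quadratic_le_exp_of_nonneg ha]

lemma mul_exp_neg_sq_le_one (s : ℝ) : s * Real.exp (-s ^ 2) ≤ 1 := by
  rw [Real.exp_neg, mul_inv_le_iff₀ (Real.exp_pos _)]
  nlinarith [Real.add_one_le_exp (s ^ 2), sq_nonneg (s - 1), sq_nonneg s]

lemma abs_centralRatio_sub_exp_le {m k : ℕ} (hk : k ≤ m) :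
    |centralRatio m k - Real.exp (-((k : ℝ) ^ 2 / (m + 1 / 2)))| ≤ 8 / (m + 1 / 2) := by
  have hM : (0 : ℝ) < (m : ℝ) + 1 / 2 := by positivity
  rw [abs_sub_comm, abs_of_nonneg (sub_nonneg.2 (centralRatio_le_exp hk))]
  set M : ℝ := (m : ℝ) + 1 / 2 with hMdef
  rcases le_or_gt (2 * (k : ℝ)) M with h | h
  · have hlow := exp_le_centralRatio h
    rw [← hMdef] at hlow
    have hdiff := exp_neg_sub_exp_neg_le ((k : ℝ) ^ 2 / M)
      ((k : ℝ) ^ 2 / M + 4 * (k : ℝ) ^ 4 / M ^ 3)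
    have hsq := sq_mul_exp_neg_le (show 0 ≤ (k : ℝ) ^ 2 / M by positivity)
    have heq : (k : ℝ) ^ 2 / M + 4 * (k : ℝ) ^ 4 / M ^ 3 - (k : ℝ) ^ 2 / M =
        4 / M * ((k : ℝ) ^ 2 / M) ^ 2 := by
      field_simp
      ring
    rw [heq, mul_assoc] at hdiff
    calc _ ≤ 4 / M * (((k : ℝ) ^ 2 / M) ^ 2 * Real.exp (-((k : ℝ) ^ 2 / M))) := by linarith
      _ ≤ 4 / M * 2 := by gcongr
      _ = 8 / M := by ring
  · have hk0 : (0 : ℝ) < k := by linarith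
    calc _ ≤ Real.exp (-((k : ℝ) ^ 2 / M)) := by linarith [centralRatio_nonneg m k]
      _ ≤ ((k : ℝ) ^ 2 / M)⁻¹ := exp_neg_le_inv (by positivity)
      _ ≤ 8 / M := by
          rw [inv_div, div_le_div_iff₀ (by positivity) hM]
          nlinarith

lemma abs_exp_sub_exp_le {m k : ℕ} (hm : 0 < m) (hk : k ≤ m) {t : ℝ}
    (hlow : (k : ℝ) * (k - 1) ≤ m * t) (hup : m * t ≤ (k : ℝ) * (k + 1)) :
    |Real.exp (-((k : ℝ) ^ 2 / (m + 1 / 2))) - Real.exp (-t)| ≤ 5 / Real.sqrt m := by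
  have hm0 : (0 : ℝ) < m := by exact_mod_cast hm
  have hkm : (k : ℝ) ≤ m := by exact_mod_cast hk
  have hk0 : (0 : ℝ) ≤ k := k.cast_nonneg
  have hs : 0 < Real.sqrt m := Real.sqrt_pos.2 hm0
  have hss : Real.sqrt m ^ 2 = m := Real.sq_sqrt hm0.le
  have ht1 : (k : ℝ) ^ 2 / m - k / m ≤ t := by
    rw [← sub_div, div_le_iff₀ hm0]; linarith
  have ht2 : t ≤ (k : ℝ) ^ 2 / m + k / m := by
    rw [← add_div, le_div_iff₀ hm0]; linarith
  have hle : (k : ℝ) ^ 2 / (m + 1 / 2) ≤ (k : ℝ) ^ 2 / m := by gcongr; linarith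
  have hge : (k : ℝ) ^ 2 / m - k / m / 2 ≤ (k : ℝ) ^ 2 / (m + 1 / 2) := by
    rw [le_div_iff₀ (by positivity), div_div, div_sub_div _ _ hm0.ne' (by positivity),
      div_mul_eq_mul_div, div_le_iff₀ (by positivity)]
    nlinarith [mul_nonneg hm0.le (mul_nonneg hk0 (sub_nonneg.2 hkm)), mul_nonneg hm0.le hk0]
  have hkm1 : (k : ℝ) / m ≤ 1 := (div_le_one hm0).2 hkm
  have hkm0 : 0 ≤ (k : ℝ) / m := by positivity
  have habs : |(k : ℝ) ^ 2 / (m + 1 / 2) - t| ≤ 3 / 2 * ((k : ℝ) / m) := by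
    rw [abs_le]; constructor <;> linarith
  have h := abs_exp_neg_sub_exp_neg_le (x := (k : ℝ) ^ 2 / (m + 1 / 2)) (y := t)
    (l := (k : ℝ) ^ 2 / m - 1) (by linarith) (by linarith)
  refine h.trans ?_
  have hexp : Real.exp (-((k : ℝ) ^ 2 / m - 1)) =
      Real.exp 1 * Real.exp (-((k : ℝ) / Real.sqrt m) ^ 2) := by
    rw [← Real.exp_add, div_pow, hss]; ring_nf
  have hfrac : (k : ℝ) / m = k / Real.sqrt m * (1 / Real.sqrt m) := by
    rw [div_mul_div_comm, mul_one, ← sq, hss]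
  have he : Real.exp 1 ≤ 3 := by linarith [Real.exp_one_lt_d9]
  calc _ ≤ 3 / 2 * ((k : ℝ) / m) * Real.exp (-((k : ℝ) ^ 2 / m - 1)) := by gcongr
    _ = 3 / 2 * Real.exp 1 * (1 / Real.sqrt m) *
        ((k : ℝ) / Real.sqrt m * Real.exp (-((k : ℝ) / Real.sqrt m) ^ 2)) := by
          rw [hexp, hfrac]; ring
    _ ≤ 3 / 2 * 3 * (1 / Real.sqrt m) * 1 := by
          gcongr
          exact mul_exp_neg_sq_le_one _
    _ ≤ 5 / Real.sqrt m := by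
          rw [mul_one, ← mul_div_assoc]; gcongr; norm_num

lemma sum_piBL_eq {m k : ℕ} (hk : k ≤ m) :
    ∑ j ∈ range k, piBL (2 * m) (m - j) = 1 - centralRatio m k := by
  induction k with
  | zero => simp [centralRatio_zero]
  | succ k ih =>
    rw [sum_range_succ, ih (by omega), piBL, if_neg (by omega), centralRatio, centralRatio,
      Nat.mul_div_cancel_left m two_pos, Nat.sub_sub]
    ring

lemma sum_piBL_eq_one (m : ℕ) : ∑ j ∈ range (m + 1), piBL (2 * m) (m - j) = 1 := by
  rw [sum_range_succ, sum_piBL_eq le_rfl]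
  simp [piBL, centralRatio]

lemma WBL_two_mul {m j : ℕ} (hj : j ≤ m) :
    WBL (2 * m) (m - j) = (j : ℝ) * (j + 1) / m := by
  rcases Nat.eq_zero_or_pos m with rfl | hm
  · simp [WBL]
  have hm0 : (m : ℝ) ≠ 0 := by exact_mod_cast hm.ne'
  rw [WBL, Nat.cast_sub hj]
  push_cast
  field_simp
  ring

lemma PBL_two_mul_s3 {m k : ℕ} (hk : k ≤ m + 1) {t : ℝ}
    (h : ∀ j ≤ m, WBL (2 * m) (m - j) ≤ t ↔ j < k) :
    PBL (2 * m) t = ∑ j ∈ range k, piBL (2 * m) (m - j) := by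
  rw [PBL, Nat.mul_div_cancel_left m two_pos, ← sum_range_reflect, ← sum_filter]
  simp only [Nat.add_sub_cancel]
  refine sum_congr ?_ fun _ _ => rfl
  ext j
  simp only [mem_filter, mem_range]
  constructor
  · rintro ⟨hj, hW⟩
    exact (h j (by omega)).1 hW
  · intro hj
    exact ⟨by omega, (h j (by omega)).2 hj⟩

/-- The eigenvalues below a threshold form an initial segment in the reflected index. -/
lemma exists_WBL_cutoff {m : ℕ} (hm : 0 < m) {t : ℝ} (ht : 0 < t) :
    ∃ k ≤ m + 1, (∀ j ≤ m, WBL (2 * m) (m - j) ≤ t ↔ j < k) ∧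
      (k : ℝ) * (k - 1) ≤ m * t ∧ (k ≤ m → m * t ≤ (k : ℝ) * (k + 1)) := by
  classical
  have hm0 : (0 : ℝ) < m := by exact_mod_cast hm
  have hex : ∃ k : ℕ, k = m + 1 ∨ m * t < (k : ℝ) * (k + 1) := ⟨m + 1, Or.inl rfl⟩
  have hmin : ∀ j < Nat.find hex, (j : ℝ) * (j + 1) ≤ m * t := fun j hj => by
    have := Nat.find_min hex hj
    push Not at this
    exact this.2
  have hspec := Nat.find_spec hex
  have hle : Nat.find hex ≤ m + 1 := Nat.find_min' hex (Or.inl rfl)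
  generalize Nat.find hex = k at hmin hspec hle
  refine ⟨k, hle, fun j hj => ?_, ?_, fun hk => ?_⟩
  · rw [WBL_two_mul hj, div_le_iff₀ hm0, mul_comm t]
    refine ⟨fun hW => ?_, hmin j⟩
    by_contra! hkj
    have hkj' : (k : ℝ) ≤ j := by exact_mod_cast hkj
    rcases hspec with hk | hk
    · omega
    · have : (k : ℝ) * (k + 1) ≤ j * (j + 1) := by gcongr
      linarith
  · rcases k with _ | k
    · simp; positivity
    · have := hmin k (by omega)
      push_cast
      linarith
  · rcases hspec with h | h
    · omega
    · exact h.le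

lemma abs_PBL_two_mul_sub_le {m : ℕ} (hm : 0 < m) {t : ℝ} (ht : 0 < t) :
    |PBL (2 * m) t - (1 - Real.exp (-t))| ≤ 13 / Real.sqrt m := by
  have hm0 : (0 : ℝ) < m := by exact_mod_cast hm
  have hm1 : (1 : ℝ) ≤ m := by exact_mod_cast hm
  have hs : 0 < Real.sqrt m := Real.sqrt_pos.2 hm0
  have hsm : Real.sqrt m ≤ m := Real.sqrt_le_iff.2 ⟨hm0.le, by nlinarith⟩
  obtain ⟨k, hk, hW, hlow, hup⟩ := exists_WBL_cutoff hm ht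
  rw [PBL_two_mul_s3 hk hW]
  rcases Nat.lt_or_ge m k with hmk | hmk
  · obtain rfl : k = m + 1 := by omega
    rw [sum_piBL_eq_one, sub_sub_cancel, abs_of_pos (Real.exp_pos _)]
    push_cast at hlow
    have hmt : (m : ℝ) ≤ t := by
      by_contra! hlt
      nlinarith
    calc Real.exp (-t) ≤ t⁻¹ := exp_neg_le_inv ht
      _ ≤ 13 / Real.sqrt m := by
          rw [inv_eq_one_div, div_le_div_iff₀ ht hs]
          linarith
  · rw [sum_piBL_eq hmk, show 1 - centralRatio m k - (1 - Real.exp (-t)) =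
      -((centralRatio m k - Real.exp (-((k : ℝ) ^ 2 / (m + 1 / 2)))) +
        (Real.exp (-((k : ℝ) ^ 2 / (m + 1 / 2))) - Real.exp (-t))) by ring, abs_neg]
    refine (abs_add_le _ _).trans ?_
    have h8 : 8 / ((m : ℝ) + 1 / 2) ≤ 8 / Real.sqrt m := by gcongr; linarith
    have h13 : 13 / Real.sqrt (m : ℝ) = 8 / Real.sqrt m + 5 / Real.sqrt m := by ring
    linarith [abs_centralRatio_sub_exp_le hmk, abs_exp_sub_exp_le hm hmk hlow (hup hmk)]

/-- Theorem 1.4 (upper bound): Berry-Esséen bound of order `n^{-1/2}` for the spectrum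
of the Bernoulli-Laplace chain. -/
theorem bernoulli_laplace_berry_esseen :
    ∃ C : ℝ, ∀ n : ℕ, Even n → 2 ≤ n → ∀ t : ℝ, 0 < t →
      |PBL n t - (1 - Real.exp (-t))| ≤ C / Real.sqrt n := by
  refine ⟨13 * Real.sqrt 2, fun n hn hn2 t ht => ?_⟩
  obtain ⟨m, rfl⟩ := even_iff_exists_two_mul.1 hn
  refine (abs_PBL_two_mul_sub_le (by omega) ht).trans_eq ?_
  rw [Nat.cast_mul, Nat.cast_ofNat, Real.sqrt_mul two_pos.le, mul_comm (13 : ℝ),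
    mul_div_mul_left _ _ (Real.sqrt_pos.2 two_pos).ne']
end

section
/- There is a sequence of even integers n tending to infinity (the even perfect squares) and corresponding real numbers t_n > 0 such that |P(W_n ≤ t_n) − P(Z ≤ t_n)| = 2e^{−2}/√n + O(1/n), where W_n takes the value W(i) := (n − 2i)(n + 2 − 2i)/(2n) with probability π(i), π(i) = (C(n,i) − C(n,i−1))/C(n, n/2) for 1 ≤ i ≤ n/2, π(0) = 1/C(n, n/2), and Z ~ Exp(1). Concretely, one may take n an even perfect square, i = n/2 − √n, and t_n = (n − 2i)(n − 2i + 2)/(2n). -/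
open Finset Filter

lemma WBL_le_WBL_iff {N i j : ℕ} (hN : 0 < N) (hi : i ≤ N) (hj : j ≤ N) :
    WBL (2 * N) j ≤ WBL (2 * N) i ↔ i ≤ j := by
  have hN' : (0 : ℝ) < N := by exact_mod_cast hN
  have hi' : (i : ℝ) ≤ N := by exact_mod_cast hi
  have hj' : (j : ℝ) ≤ N := by exact_mod_cast hj
  unfold WBL
  push_cast
  rw [div_le_div_iff_of_pos_right (by positivity)]
  constructor
  · intro h
    by_contra! hlt
    have hlt' : (j : ℝ) < i := by exact_mod_cast hlt
    nlinarith
  · intro h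
    have h' : (i : ℝ) ≤ j := by exact_mod_cast h
    nlinarith

/-- The distribution function of the spectral measure at an eigenvalue, by telescoping. -/
lemma PBL_WBL {N i : ℕ} (hi : 1 ≤ i) (hiN : i ≤ N) :
    PBL (2 * N) (WBL (2 * N) i) =
      1 - ((2 * N).choose (i - 1) : ℝ) / ((2 * N).choose N : ℝ) := by
  have hN : 0 < N := by omega
  have hC : ((2 * N).choose N : ℝ) ≠ 0 := by
    exact_mod_cast (Nat.choose_pos (by omega)).ne'
  have hhalf : 2 * N / 2 = N := by omega
  have hsum : ∀ M, i ≤ M + 1 → ∑ j ∈ Finset.Ico i (M + 1), piBL (2 * N) j =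
      (((2 * N).choose M : ℝ) - (2 * N).choose (i - 1)) / (2 * N).choose N := by
    intro M hM
    obtain ⟨d, rfl⟩ : ∃ d, M = i - 1 + d := ⟨M + 1 - i, by omega⟩
    clear hM
    induction d with
    | zero => simp [show i - 1 + 1 = i by omega]
    | succ d ih =>
      rw [show i - 1 + (d + 1) + 1 = (i - 1 + d + 1) + 1 by omega,
        Finset.sum_Ico_succ_top (by omega), ih, piBL, if_neg (by omega), hhalf, ← add_div]
      congr 1
      rw [show i - 1 + d + 1 - 1 = i - 1 + d by omega,
        show i - 1 + d + 1 = i - 1 + (d + 1) by omega]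
      ring
  have hfilter : (Finset.range (N + 1)).filter (fun j ↦ WBL (2 * N) j ≤ WBL (2 * N) i) =
      Finset.Ico i (N + 1) := by
    ext j
    simp only [Finset.mem_filter, Finset.mem_range, Finset.mem_Ico]
    constructor
    · rintro ⟨h1, h2⟩
      exact ⟨(WBL_le_WBL_iff hN hiN (by omega)).1 h2, h1⟩
    · rintro ⟨h1, h2⟩
      exact ⟨h2, (WBL_le_WBL_iff hN hiN (by omega)).2 h1⟩
  rw [PBL, hhalf, ← Finset.sum_filter, hfilter, hsum N (by omega), sub_div, div_self hC]

lemma abs_log_one_sub_sub_log_one_add_le {x : ℝ} (h0 : 0 ≤ x) (hx : x ≤ 1 / 2) :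
    |Real.log (1 - x) - Real.log (1 + x) + 2 * x| ≤ 4 * x ^ 3 := by
  have h1 := Real.abs_log_sub_add_sum_range_le (x := x) (by rw [abs_of_nonneg h0]; linarith) 2
  have h2 := Real.abs_log_sub_add_sum_range_le (x := -x)
    (by rw [abs_neg, abs_of_nonneg h0]; linarith) 2
  have h3 : x ^ 3 / (1 - x) ≤ 2 * x ^ 3 := by
    rw [div_le_iff₀ (by linarith)]
    nlinarith [pow_nonneg h0 3]
  simp only [Finset.sum_range_succ, Finset.sum_range_zero, abs_neg, abs_of_nonneg h0,
    sub_neg_eq_add] at h1 h2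
  norm_num at h1 h2
  rw [abs_le] at *
  constructor <;> linarith [h1.1, h1.2, h2.1, h2.2]

lemma abs_log_one_add_sub_le {x : ℝ} (h0 : 0 ≤ x) (hx : x ≤ 1 / 2) :
    |Real.log (1 + x) - x| ≤ 2 * x ^ 2 := by
  have h2 := Real.abs_log_sub_add_sum_range_le (x := -x)
    (by rw [abs_neg, abs_of_nonneg h0]; linarith) 1
  have h3 : x ^ 2 / (1 - x) ≤ 2 * x ^ 2 := by
    rw [div_le_iff₀ (by linarith)]
    nlinarith [pow_nonneg h0 2]
  simp only [Finset.sum_range_succ, Finset.sum_range_zero, abs_neg, abs_of_nonneg h0,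
    sub_neg_eq_add] at h2
  norm_num at h2
  rw [abs_le] at *
  constructor <;> linarith [h2.1, h2.2]

lemma log_choose_sub_succ {N m : ℕ} (hm : m < N) :
    Real.log ((2 * N).choose (N - (m + 1))) + Real.log (1 + ((m + 1 : ℕ) : ℝ) / N) =
      Real.log ((2 * N).choose (N - m)) + Real.log (1 - (m : ℝ) / N) := by
  have hN : (0 : ℝ) < N := by exact_mod_cast (by omega : 0 < N)
  have hm' : (m : ℝ) < N := by exact_mod_cast hm
  have hpos : ∀ j, j ≤ N → (0 : ℝ) < (2 * N).choose j := fun j hj ↦ by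
    exact_mod_cast Nat.choose_pos (by omega)
  have key : ((2 * N).choose (N - m) : ℝ) * (N - m) =
      (2 * N).choose (N - (m + 1)) * (N + (m + 1)) := by
    have h := Nat.choose_succ_right_eq (2 * N) (N - (m + 1))
    rw [show N - (m + 1) + 1 = N - m by omega,
      show 2 * N - (N - (m + 1)) = N + (m + 1) by omega] at h
    have h' := congrArg (Nat.cast (R := ℝ)) h
    push_cast [Nat.cast_sub hm.le] at h'
    exact h'
  have h1 : 0 < 1 - (m : ℝ) / N := by
    rw [sub_pos, div_lt_one hN]
    exact hm'
  rw [← Real.log_mul (hpos _ (by omega)).ne' (by positivity),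
    ← Real.log_mul (hpos _ (by omega)).ne' h1.ne']
  congr 1
  push_cast
  field_simp
  linarith

lemma abs_log_choose_sub_add_le {N m : ℕ} (hN : 0 < N) (hm : 2 * m ≤ N) :
    |Real.log ((2 * N).choose (N - m)) - Real.log ((2 * N).choose N) + Real.log (1 + (m : ℝ) / N)
      + (m : ℝ) * (m - 1) / N| ≤ 4 * (m : ℝ) ^ 4 / N ^ 3 := by
  have hN' : (0 : ℝ) < N := by exact_mod_cast hN
  induction m with
  | zero => simp
  | succ m ih =>
    have ih := ih (by omega)
    have hm' : 2 * (m : ℝ) ≤ N := by exact_mod_cast (by omega : 2 * m ≤ N)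
    have hrec := log_choose_sub_succ (N := N) (m := m) (by omega)
    have hlog := abs_log_one_sub_sub_log_one_add_le (x := (m : ℝ) / N) (by positivity)
      (by rw [div_le_iff₀ hN']; linarith)
    have hid : Real.log ((2 * N).choose (N - (m + 1))) - Real.log ((2 * N).choose N)
        + Real.log (1 + ((m + 1 : ℕ) : ℝ) / N) + ((m + 1 : ℕ) : ℝ) * ((m + 1 : ℕ) - 1) / N =
        (Real.log ((2 * N).choose (N - m)) - Real.log ((2 * N).choose N)
          + Real.log (1 + (m : ℝ) / N) + (m : ℝ) * (m - 1) / N) +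
        (Real.log (1 - (m : ℝ) / N) - Real.log (1 + (m : ℝ) / N) + 2 * ((m : ℝ) / N)) := by
      have : ((m + 1 : ℕ) : ℝ) * ((m + 1 : ℕ) - 1) / N =
          (m : ℝ) * (m - 1) / N + 2 * ((m : ℝ) / N) := by
        push_cast
        ring
      linarith
    rw [hid]
    refine (abs_add_le _ _).trans ((add_le_add ih hlog).trans ?_)
    rw [div_pow, mul_div_assoc', ← add_div]
    refine div_le_div_of_nonneg_right ?_ (by positivity)
    push_cast
    have h0 : (0 : ℝ) ≤ m := by positivity
    nlinarith [pow_nonneg h0 2, pow_nonneg h0 3]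

/-- Local central limit estimate for the ratio to the central binomial coefficient. -/
lemma abs_log_choose_ratio_add_sq_le {N m : ℕ} (hN : 0 < N) (hm : 2 * m ≤ N) :
    |Real.log (((2 * N).choose (N - m) : ℝ) / (2 * N).choose N) + (m : ℝ) ^ 2 / N| ≤
      4 * (m : ℝ) ^ 4 / N ^ 3 + 2 * ((m : ℝ) / N) ^ 2 := by
  have hN' : (0 : ℝ) < N := by exact_mod_cast hN
  have hm' : 2 * (m : ℝ) ≤ N := by exact_mod_cast hm
  have hpos : ∀ j, j ≤ N → (0 : ℝ) < (2 * N).choose j := fun j hj ↦ by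
    exact_mod_cast Nat.choose_pos (by omega)
  have h1 := abs_log_choose_sub_add_le hN hm
  have h2 := abs_log_one_add_sub_le (x := (m : ℝ) / N) (by positivity)
    (by rw [div_le_iff₀ hN']; linarith)
  rw [Real.log_div (hpos _ (by omega)).ne' (hpos _ le_rfl).ne']
  have h3 : (m : ℝ) ^ 2 / N = (m : ℝ) * (m - 1) / N + (m : ℝ) / N := by ring
  rw [abs_le] at *
  constructor <;> linarith [h1.1, h1.2, h2.1, h2.2]

lemma abs_choose_ratio_sub_le {k : ℕ} (hk : 48 ≤ k) :
    |((2 * (2 * k ^ 2)).choose (2 * k ^ 2 - (2 * k + 1)) : ℝ) / (2 * (2 * k ^ 2)).choose (2 * k ^ 2)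
      - Real.exp (-2) * (1 - 2 / k)| ≤ 2350 / (k : ℝ) ^ 2 := by
  have hk' : (48 : ℝ) ≤ k := by exact_mod_cast hk
  have hk0 : (0 : ℝ) < k := by linarith
  have hpos : ∀ j, j ≤ 2 * k ^ 2 → (0 : ℝ) < (2 * (2 * k ^ 2)).choose j := fun j hj ↦ by
    exact_mod_cast Nat.choose_pos (by omega)
  have hr := div_pos (hpos (2 * k ^ 2 - (2 * k + 1)) (by omega)) (hpos _ le_rfl)
  have h := abs_log_choose_ratio_add_sq_le (N := 2 * k ^ 2) (m := 2 * k + 1) (by positivity)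
    (by nlinarith)
  generalize ((2 * (2 * k ^ 2)).choose (2 * k ^ 2 - (2 * k + 1)) : ℝ) /
    (2 * (2 * k ^ 2)).choose (2 * k ^ 2) = r at h hr ⊢
  push_cast at h
  set u : ℝ := 1 / k with hu
  have hu0 : 0 < u := by positivity
  have hu1 : u ≤ 1 / 48 := one_div_le_one_div_of_le (by norm_num) hk'
  have hku : (k : ℝ) = 1 / u := by rw [hu, one_div_one_div]
  have e1 : (2 * (k : ℝ) + 1) ^ 2 / (2 * k ^ 2) = 2 + 2 * u + u ^ 2 / 2 := by
    rw [hku]; field_simp; ring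
  have e2 : 4 * (2 * (k : ℝ) + 1) ^ 4 / (2 * k ^ 2) ^ 3 + 2 * ((2 * (k : ℝ) + 1) / (2 * k ^ 2)) ^ 2
      = ((2 + u) ^ 4 + (2 + u) ^ 2) / 2 * u ^ 2 := by
    rw [hku]; field_simp; ring
  have e3 : (2 : ℝ) / k = 2 * u := by rw [hu]; ring
  have e4 : 2350 / (k : ℝ) ^ 2 = 2350 * u ^ 2 := by rw [hu]; ring
  rw [e1, e2] at h
  rw [e3, e4]
  have hb : ((2 + u) ^ 4 + (2 + u) ^ 2) / 2 * u ^ 2 ≤ 45 * u ^ 2 := by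
    refine mul_le_mul_of_nonneg_right ?_ (by positivity)
    have : (2 + u) ^ 2 ≤ 9 := by nlinarith
    have : (2 + u) ^ 4 ≤ 81 := by nlinarith [sq_nonneg (2 + u)]
    linarith
  have hx : |Real.log r + 2 + 2 * u| ≤ 46 * u ^ 2 := by
    rw [abs_le] at *
    constructor <;> nlinarith [h.1, h.2]
  set x := Real.log r + 2 with hxdef
  have hx' : |x| ≤ 48 * u := by
    rw [abs_le] at *
    constructor <;> nlinarith [hx.1, hx.2]
  have hexp := Real.abs_exp_sub_one_sub_id_le (x := x) (by linarith)
  have hx2 : x ^ 2 ≤ 2304 * u ^ 2 := by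
    rw [← sq_abs]
    nlinarith [abs_nonneg x]
  have hrx : r = Real.exp (-2) * Real.exp x := by
    rw [← Real.exp_add, hxdef, neg_add_cancel_comm_assoc, Real.exp_log hr]
  rw [hrx, ← mul_sub, abs_mul, abs_of_pos (Real.exp_pos _)]
  have hd : |Real.exp x - (1 - 2 * u)| ≤ 2350 * u ^ 2 := by
    rw [abs_le] at *
    constructor <;> linarith [hx.1, hx.2, hexp.1, hexp.2]
  exact (mul_le_of_le_one_left (abs_nonneg _) (by simp)).trans hd

/-- The Kolmogorov estimate for `n = 4 k²`, with an explicit constant for `k` not too small. -/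
lemma abs_PBL_sub_le {k : ℕ} (hk : 48 ≤ k) {t : ℝ}
    (ht : t = WBL (4 * k ^ 2) (4 * k ^ 2 / 2 - 2 * k)) :
    |(|PBL (4 * k ^ 2) t - (1 - Real.exp (-t))|) -
      2 * Real.exp (-2) / Real.sqrt ((4 * k ^ 2 : ℕ) : ℝ)| ≤ 9404 / ((4 * k ^ 2 : ℕ) : ℝ) := by
  have hk' : (48 : ℝ) ≤ k := by exact_mod_cast hk
  have hk0 : (0 : ℝ) < k := by linarith
  have hkk : 2 * k + 1 ≤ 2 * k ^ 2 := by nlinarith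
  have hn : 4 * k ^ 2 = 2 * (2 * k ^ 2) := by ring
  have hi : 4 * k ^ 2 / 2 - 2 * k = 2 * k ^ 2 - 2 * k := by omega
  have hP : PBL (4 * k ^ 2) t = 1 - ((2 * (2 * k ^ 2)).choose (2 * k ^ 2 - (2 * k + 1)) : ℝ) /
      (2 * (2 * k ^ 2)).choose (2 * k ^ 2) := by
    rw [ht, hi, hn, PBL_WBL (by omega) (by omega), Nat.sub_sub]
  have htv : t = 2 + 1 / k := by
    rw [ht, hi, WBL, Nat.cast_sub (by omega)]
    push_cast
    field_simp
    ring
  have hsqrt : Real.sqrt ((4 * k ^ 2 : ℕ) : ℝ) = 2 * k := by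
    rw [show ((4 * k ^ 2 : ℕ) : ℝ) = (2 * k) ^ 2 by push_cast; ring, Real.sqrt_sq (by positivity)]
  have hr := abs_choose_ratio_sub_le hk
  have hu1 : |-(1 / (k : ℝ))| ≤ 1 := by
    rw [abs_neg, abs_of_pos (by positivity), div_le_one hk0]
    linarith
  have hexp := Real.abs_exp_sub_one_sub_id_le hu1
  have hexp2 : |Real.exp (-t) - Real.exp (-2) * (1 - 1 / k)| ≤ 1 / (k : ℝ) ^ 2 := by
    rw [htv, neg_add, Real.exp_add, ← mul_sub, abs_mul, abs_of_pos (Real.exp_pos _)]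
    refine (mul_le_of_le_one_left (abs_nonneg _) (by simp)).trans ?_
    rw [neg_sq, one_div_pow] at hexp
    rwa [sub_sub, ← sub_eq_add_neg] at hexp
  have hy : (0 : ℝ) ≤ 2 * Real.exp (-2) / (2 * k) := by positivity
  rw [hP, hsqrt]
  rw [← abs_of_nonneg hy]
  refine (abs_abs_sub_abs_le _ _).trans ?_
  have e1 : 2 * Real.exp (-2) / (2 * k) = Real.exp (-2) * (1 / k) := by field_simp
  have e2 : Real.exp (-2) * (1 - 2 / (k : ℝ)) =
      Real.exp (-2) * (1 - 1 / k) - Real.exp (-2) * (1 / k) := by ring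
  have e3 : 9404 / ((4 * k ^ 2 : ℕ) : ℝ) = 2350 / (k : ℝ) ^ 2 + 1 / (k : ℝ) ^ 2 := by
    push_cast
    field_simp
    norm_num
  rw [e1, e3]
  rw [e2] at hr
  rw [abs_le] at *
  constructor <;> linarith [hr.1, hr.2, hexp2.1, hexp2.2]

/-- A bound valid for all large indices extends to all positive indices, after enlarging the
constant. -/
lemma exists_forall_le_div_of_forall_ge {f g : ℕ → ℝ} (hg : ∀ k, 1 ≤ k → 0 < g k) (K : ℕ) (M : ℝ)
    (h : ∀ k, K ≤ k → f k ≤ M / g k) : ∃ M' : ℝ, ∀ k, 1 ≤ k → f k ≤ M' / g k := by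
  refine ⟨|M| + ∑ j ∈ Finset.range K, |f j * g j|, fun k hk ↦ ?_⟩
  have hS : 0 ≤ ∑ j ∈ Finset.range K, |f j * g j| := Finset.sum_nonneg fun _ _ ↦ abs_nonneg _
  rw [le_div_iff₀ (hg k hk)]
  rcases le_or_gt K k with hKk | hKk
  · have := (le_div_iff₀ (hg k hk)).1 (h k hKk)
    linarith [le_abs_self M]
  · have := Finset.single_le_sum (f := fun j ↦ |f j * g j|) (fun _ _ ↦ abs_nonneg _)
      (Finset.mem_range.2 hKk)
    linarith [le_abs_self (f k * g k), abs_nonneg M]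

/-- Proposition 4.7 (lower bound): along even perfect squares `n = 4k²`, with
`i = n/2 - √n` and `t_n = (n-2i)(n-2i+2)/(2n)`, the Kolmogorov distance at `t_n`
equals `2e^{-2}/√n + O(1/n)`. -/
theorem bernoulli_laplace_lower_bound :
    ∃ M : ℝ, ∀ k : ℕ, 1 ≤ k →
      let n : ℕ := 4 * k ^ 2
      let i : ℕ := n / 2 - 2 * k
      let t : ℝ := ((n : ℝ) - 2 * i) * ((n : ℝ) - 2 * i + 2) / (2 * n)
      abs (|PBL n t - (1 - Real.exp (-t))| - 2 * Real.exp (-2) / Real.sqrt n) ≤ M / n := by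
  refine exists_forall_le_div_of_forall_ge (g := fun k ↦ ((4 * k ^ 2 : ℕ) : ℝ))
    (fun k hk ↦ by positivity) 48 9404 fun k hk ↦ abs_PBL_sub_le hk ?_
  rw [WBL]
  ring
end

section
/- Let W and W' be real-valued random variables on the same probability space with the same distribution, and let D := W' − W. Then for every t ∈ ℝ and every c > 0, E(D²·1[|W − t| ≤ |D|]) ≤ 4c·E|E(D|W)| + E(D²·1[|D| > c]). -/
open MeasureTheory Real

/-- The truncation of `x` to the interval `[-a, a]`. -/
noncomputable def truncate (a x : ℝ) : ℝ := max (-a) (min a x)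

/-- The Huber function with threshold `a`: the antiderivative of `truncate a` vanishing at `0`. -/
noncomputable def huber (a x : ℝ) : ℝ := truncate a x * x - truncate a x ^ 2 / 2

lemma truncate_of_abs_le {a x : ℝ} (h : |x| ≤ a) : truncate a x = x := by
  obtain ⟨h₁, h₂⟩ := abs_le.1 h
  rw [truncate, min_eq_right h₂, max_eq_right h₁]

lemma abs_truncate_le {a : ℝ} (ha : 0 ≤ a) (x : ℝ) : |truncate a x| ≤ a :=
  abs_le.2 ⟨le_max_left _ _, max_le (by linarith) (min_le_left _ _)⟩

lemma measurable_truncate (a : ℝ) : Measurable (truncate a) := by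
  unfold truncate
  fun_prop

lemma measurable_huber (a : ℝ) : Measurable (huber a) := by
  have := measurable_truncate a
  unfold huber
  fun_prop

lemma abs_truncate_sub_le (a x y : ℝ) : |truncate a x - truncate a y| ≤ |x - y| := by
  refine (abs_max_sub_max_le_max _ _ _ _).trans (max_le (by simp) ?_)
  exact (abs_min_sub_min_le_max _ _ _ _).trans (max_le (by simp) le_rfl)

/-- The tangent line inequality for the convex function `huber a`. -/
lemma truncate_mul_sub_le_huber_sub {a : ℝ} (ha : 0 ≤ a) (x y : ℝ) :
    truncate a x * (y - x) ≤ huber a y - huber a x := by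
  have key : 0 ≤ (truncate a y - truncate a x) * (2 * y - truncate a x - truncate a y) := by
    obtain ⟨hx₁, hx₂⟩ := abs_le.1 (abs_truncate_le ha x)
    rcases le_total y (-a) with h | h
    · rw [show truncate a y = -a by rw [truncate, min_eq_right (by linarith), max_eq_left h]]
      exact mul_nonneg_of_nonpos_of_nonpos (by linarith) (by linarith)
    rcases le_total y a with h' | h'
    · rw [truncate_of_abs_le (abs_le.2 ⟨h, h'⟩)]
      nlinarith [sq_nonneg (y - truncate a x)]
    · rw [show truncate a y = a by rw [truncate, min_eq_left h', max_eq_right (by linarith)]]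
      exact mul_nonneg (by linarith) (by linarith)
  unfold huber
  linarith

lemma abs_huber_sub_le {a : ℝ} (ha : 0 ≤ a) (x y : ℝ) :
    |huber a y - huber a x| ≤ a * |y - x| := by
  have bound (z : ℝ) : |truncate a z * (y - x)| ≤ a * |y - x| := by
    rw [abs_mul]
    exact mul_le_mul_of_nonneg_right (abs_truncate_le ha z) (abs_nonneg _)
  have h₁ := truncate_mul_sub_le_huber_sub ha x y
  have h₂ := truncate_mul_sub_le_huber_sub ha y x
  exact abs_le.2 ⟨by linarith [(abs_le.1 (bound x)).1], by linarith [(abs_le.1 (bound y)).2]⟩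

/-- The difference of two identically distributed random variables has mean zero as soon as it is
integrable, even if the variables themselves are not. -/
lemma ProbabilityTheory.IdentDistrib.integral_sub_eq_zero {Ω : Type*} [MeasurableSpace Ω]
    {μ : Measure Ω} [IsFiniteMeasure μ] {X Y : Ω → ℝ} (h : IdentDistrib X Y μ μ)
    (hint : Integrable (fun ω => X ω - Y ω) μ) : ∫ ω, (X ω - Y ω) ∂μ = 0 := by
  have htrunc (Z : Ω → ℝ) (hZ : AEMeasurable Z μ) (n : ℕ) :
      Integrable (fun ω => truncate n (Z ω)) μ :=
    Integrable.of_bound ((measurable_truncate n).comp_aemeasurable hZ).aestronglyMeasurable n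
      (.of_forall fun ω => abs_truncate_le n.cast_nonneg _)
  have hlim : Filter.Tendsto (fun n : ℕ => ∫ ω, (truncate n (X ω) - truncate n (Y ω)) ∂μ)
      Filter.atTop (nhds (∫ ω, (X ω - Y ω) ∂μ)) := by
    refine tendsto_integral_of_dominated_convergence (fun ω => |X ω - Y ω|)
      (fun n => ((htrunc X h.aemeasurable_fst n).sub
        (htrunc Y h.aemeasurable_snd n)).aestronglyMeasurable) hint.abs
      (fun n => .of_forall fun ω => abs_truncate_sub_le _ _ _) (.of_forall fun ω => ?_)
    refine tendsto_const_nhds.congr' ?_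
    filter_upwards [tendsto_natCast_atTop_atTop.eventually_ge_atTop |X ω|,
      tendsto_natCast_atTop_atTop.eventually_ge_atTop |Y ω|] with n hX hY
    rw [truncate_of_abs_le hX, truncate_of_abs_le hY]
  refine tendsto_nhds_unique hlim (tendsto_const_nhds.congr fun n => ?_)
  rw [integral_sub (htrunc X h.aemeasurable_fst n) (htrunc Y h.aemeasurable_snd n)]
  exact (sub_eq_zero.2 (h.comp (measurable_truncate n)).integral_eq).symm

lemma abs_integral_mul_le_of_abs_le {Ω : Type*} {m m₀ : MeasurableSpace Ω} {μ : Measure Ω}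
    [IsFiniteMeasure μ] (hm : m ≤ m₀) {f g : Ω → ℝ} {a : ℝ} (hf : StronglyMeasurable[m] f)
    (hfa : ∀ ω, |f ω| ≤ a) (hg : Integrable g μ) :
    |∫ ω, f ω * g ω ∂μ| ≤ a * ∫ ω, |(μ[g | m]) ω| ∂μ := by
  have hfg : Integrable (f * g) μ :=
    hg.bdd_mul (hf.mono hm).aestronglyMeasurable (.of_forall hfa)
  have heq : ∫ ω, f ω * g ω ∂μ = ∫ ω, f ω * (μ[g | m]) ω ∂μ :=
    (integral_condExp hm (f := f * g)).symm.trans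
      (integral_congr_ae (condExp_mul_of_stronglyMeasurable_left hf hfg hg))
  rw [heq, ← integral_const_mul]
  rw [← norm_eq_abs]
  refine norm_integral_le_of_norm_le (integrable_condExp.abs.const_mul a) (.of_forall fun ω => ?_)
  rw [norm_eq_abs, abs_mul]
  exact mul_le_mul_of_nonneg_right (hfa ω) (abs_nonneg _)

/-- Theorem 2.2 (tool1). -/
theorem tool1
    {Ω : Type*} [MeasurableSpace Ω] {μ : Measure Ω} [IsProbabilityMeasure μ]
    (W W' : Ω → ℝ) (hW : Measurable W) (hW' : Measurable W')
    (hdist : μ.map W = μ.map W')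
    (D : Ω → ℝ) (hDdef : D = fun ω => W' ω - W ω)
    (hD1 : Integrable D μ)
    (hD2 : Integrable (fun ω => (D ω) ^ 2) μ)
    (t : ℝ) (c : ℝ) (hc : 0 < c) :
    (∫ ω, (D ω) ^ 2 * Set.indicator {ω' | |W ω' - t| ≤ |D ω'|} (fun _ => (1 : ℝ)) ω ∂μ) ≤
      4 * c * (∫ ω, |(μ[D | MeasurableSpace.comap W inferInstance]) ω| ∂μ)
      + (∫ ω, (D ω) ^ 2 * Set.indicator {ω' | c < |D ω'|} (fun _ => (1 : ℝ)) ω ∂μ) := by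
  have ha : 0 ≤ 2 * c := by positivity
  have hD (ω : Ω) : W' ω - W ω = D ω := by rw [hDdef]
  have hDm : Measurable D := hDdef ▸ hW'.sub hW
  let f : Ω → ℝ := fun ω => truncate (2 * c) (W ω - t)
  let Δ : Ω → ℝ := fun ω => huber (2 * c) (W' ω - t) - huber (2 * c) (W ω - t)
  have hh : Measurable fun x => huber (2 * c) (x - t) :=
    (measurable_huber _).comp (measurable_id.sub_const t)
  have hΔ : Integrable Δ μ := by
    refine (hD1.abs.const_mul (2 * c)).mono' ((hh.comp hW').sub (hh.comp hW)).aestronglyMeasurable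
      (.of_forall fun ω => (abs_huber_sub_le ha _ _).trans_eq ?_)
    rw [sub_sub_sub_cancel_right, hD]
  have hΔ₀ : ∫ ω, Δ ω ∂μ = 0 :=
    ((ProbabilityTheory.IdentDistrib.mk hW'.aemeasurable hW.aemeasurable
      hdist.symm).comp hh).integral_sub_eq_zero hΔ
  have hfW : StronglyMeasurable[MeasurableSpace.comap W inferInstance] f :=
    (((measurable_truncate _).comp (measurable_id.sub_const t)).comp
      (comap_measurable W)).stronglyMeasurable
  have hfa (ω : Ω) : |f ω| ≤ 2 * c := abs_truncate_le ha _
  have hfD : Integrable (fun ω => f ω * D ω) μ :=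
    hD1.bdd_mul (hfW.mono hW.comap_le).aestronglyMeasurable (.of_forall hfa)
  have hcond := abs_integral_mul_le_of_abs_le hW.comap_le hfW hfa hD1
  have hind {s : Set Ω} (hs : MeasurableSet s) :
      Integrable (fun ω => D ω ^ 2 * s.indicator (fun _ => (1 : ℝ)) ω) μ := by
    refine (hD2.indicator hs).congr (.of_forall fun ω => ?_)
    by_cases h : ω ∈ s <;> simp [h]
  have hs₁ : MeasurableSet {ω | |W ω - t| ≤ |D ω|} :=
    measurableSet_le (hW.sub_const t).abs hDm.abs
  have hs₂ : MeasurableSet {ω | c < |D ω|} := measurableSet_lt measurable_const hDm.abs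
  have hR : Integrable (fun ω => 2 * (Δ ω - f ω * D ω)) μ := (hΔ.sub hfD).const_mul 2
  have hpt (ω : Ω) : D ω ^ 2 * Set.indicator {ω' | |W ω' - t| ≤ |D ω'|} (fun _ => (1 : ℝ)) ω ≤
      2 * (Δ ω - f ω * D ω)
        + D ω ^ 2 * Set.indicator {ω' | c < |D ω'|} (fun _ => (1 : ℝ)) ω := by
    have hconv : f ω * D ω ≤ Δ ω := by
      have := truncate_mul_sub_le_huber_sub ha (W ω - t) (W' ω - t)
      rwa [sub_sub_sub_cancel_right, hD] at this
    have hsq := sq_nonneg (D ω)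
    by_cases h₁ : |W ω - t| ≤ |D ω| <;> by_cases h₂ : c < |D ω| <;>
      simp only [Set.indicator, Set.mem_ofPred_eq, h₁, h₂, if_true, if_false, mul_one, mul_zero]
    · linarith
    · have hx : |W ω - t| ≤ 2 * c := by linarith
      have hy : |W' ω - t| ≤ 2 * c := by
        rw [show W' ω - t = (W ω - t) + D ω by rw [← hD]; ring]
        exact (abs_add_le _ _).trans (by linarith)
      simp only [Δ, f, huber, truncate_of_abs_le hx, truncate_of_abs_le hy, ← hD]
      exact le_of_eq (by ring)
    · linarith
    · linarith
  refine (integral_mono (hind hs₁) (hR.add (hind hs₂)) hpt).trans ?_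
  simp only [Pi.add_apply]
  rw [integral_add hR (hind hs₂), integral_const_mul, integral_sub hΔ hfD, hΔ₀]
  linarith [(abs_le.1 hcond).1]
end

section
/- For every t > 0, the function f : (0,∞) → ℝ defined by f(x) := (e^{−(t−x)⁺} − e^{−t})/x (where (u)⁺ := max(u,0)), with f' denoting the left-hand derivative of f, satisfies the equation x·f'(x) − (x − 1)·f(x) = 1[x ≤ t] − (1 − e^{−t}) for all x > 0, together with the bounds ‖f'‖_∞ ≤ t⁻¹ and ‖f''‖_∞ ≤ max{t⁻¹, 2t⁻²}, where f'' denotes the left-hand derivative of f'. Moreover 0 ≤ f(x) ≤ (1 − e^{−t})/t ≤ 1 for all x > 0, with f' ≥ 0 on (0, t] and f' ≤ 0 on (t, ∞). -/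
open Real Set

theorem hasDerivAt_exp_sub_one_div {x : ℝ} (hx : x ≠ 0) :
    HasDerivAt (fun y : ℝ => (exp y - 1) / y) ((x * exp x - exp x + 1) / x ^ 2) x := by
  refine HasDerivAt.congr_deriv
    (((Real.hasDerivAt_exp x).sub_const 1).fun_div (hasDerivAt_id' x) hx) ?_
  ring

theorem hasDerivAt_deriv_exp_sub_one_div {x : ℝ} (hx : x ≠ 0) :
    HasDerivAt (fun y : ℝ => (y * exp y - exp y + 1) / y ^ 2)
      ((x ^ 2 * exp x - 2 * x * exp x + 2 * exp x - 2) / x ^ 3) x := by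
  have h : HasDerivAt (fun y : ℝ => y * exp y - exp y + 1) (x * exp x) x := by
    refine HasDerivAt.congr_deriv ((((hasDerivAt_id' x).fun_mul (Real.hasDerivAt_exp x)).fun_sub
      (Real.hasDerivAt_exp x)).add_const 1) ?_
    ring
  refine HasDerivAt.congr_deriv (h.fun_div (hasDerivAt_pow 2 x) (pow_ne_zero 2 hx)) ?_
  push_cast
  field_simp
  ring

theorem mul_exp_sub_exp_add_one_nonneg (x : ℝ) : 0 ≤ x * exp x - exp x + 1 := by
  have h := Real.add_one_le_exp (-x)
  have h2 : exp (-x) * exp x = 1 := by rw [← Real.exp_add]; simp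
  nlinarith [Real.exp_pos x]

theorem exp_sub_one_div_le_of_le {x t : ℝ} (hx : 0 < x) (hxt : x ≤ t) :
    (exp x - 1) / x ≤ (exp t - 1) / t := by
  have h := Real.add_one_le_exp (t - x)
  have h2 : exp t = exp x * exp (t - x) := by rw [← Real.exp_add]; ring_nf
  have h3 : exp x * (t - x + 1) ≤ exp t := by
    rw [h2]; exact mul_le_mul_of_nonneg_left h (Real.exp_pos x).le
  rw [div_le_div_iff₀ hx (hx.trans_le hxt)]
  nlinarith [mul_le_mul_of_nonneg_left h3 hx.le,
    mul_nonneg (sub_nonneg.2 hxt) (mul_exp_sub_exp_add_one_nonneg x)]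

theorem deriv_exp_sub_one_div_le {x : ℝ} (hx : 0 < x) :
    (x * exp x - exp x + 1) / x ^ 2 ≤ (exp x - 1) / x := by
  rw [div_le_div_iff₀ (by positivity) hx]
  nlinarith [mul_nonneg hx.le (sub_nonneg.2 (Real.add_one_le_exp x))]

theorem sq_mul_exp_sub_nonneg {x : ℝ} (hx : 0 ≤ x) :
    0 ≤ x ^ 2 * exp x - 2 * x * exp x + 2 * exp x - 2 := by
  have hd : ∀ y : ℝ, HasDerivAt (fun y : ℝ => y ^ 2 * exp y - 2 * y * exp y + 2 * exp y - 2)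
      (y ^ 2 * exp y) y := by
    intro y
    have he := Real.hasDerivAt_exp y
    refine HasDerivAt.congr_deriv (((((hasDerivAt_pow 2 y).fun_mul he).fun_sub
      (((hasDerivAt_id' y).const_mul 2).fun_mul he)).fun_add (he.const_mul 2)).sub_const 2) ?_
    push_cast
    ring
  simpa using monotone_of_hasDerivAt_nonneg hd (fun y => by positivity) hx

theorem second_deriv_exp_sub_one_div_le {x : ℝ} (hx : 0 < x) :
    (x ^ 2 * exp x - 2 * x * exp x + 2 * exp x - 2) / x ^ 3 ≤ (exp x - 1) / x := by
  have hd : ∀ y : ℝ, HasDerivAt (fun y : ℝ => 2 * y * exp y - 2 * exp y - y ^ 2)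
      (2 * (y * (exp y - 1))) y := by
    intro y
    have he := Real.hasDerivAt_exp y
    refine HasDerivAt.congr_deriv (((((hasDerivAt_id' y).const_mul 2).fun_mul he).fun_sub
      (he.const_mul 2)).fun_sub (hasDerivAt_pow 2 y)) ?_
    push_cast
    ring
  have hnn : ∀ y : ℝ, 0 ≤ 2 * (y * (exp y - 1)) := by
    intro y
    rcases le_total 0 y with hy | hy
    · have := Real.one_le_exp hy
      exact mul_nonneg zero_le_two (mul_nonneg hy (by linarith))
    · have := Real.exp_le_one_iff.2 hy
      exact mul_nonneg zero_le_two (mul_nonneg_of_nonpos_of_nonpos hy (by linarith))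
  have h : -2 ≤ 2 * x * exp x - 2 * exp x - x ^ 2 := by
    simpa using monotone_of_hasDerivAt_nonneg hd hnn hx.le
  rw [div_le_div_iff₀ (by positivity) hx]
  nlinarith [mul_le_mul_of_nonneg_left h hx.le]

theorem exp_sub_one_div_mul_exp_neg_le_inv {t : ℝ} (ht : 0 < t) :
    (exp t - 1) / t * exp (-t) ≤ t⁻¹ := by
  have h : exp t * exp (-t) = 1 := by rw [← Real.exp_add]; simp
  have h2 : (exp t - 1) / t * exp (-t) = (1 - exp (-t)) * t⁻¹ := by
    linear_combination t⁻¹ * h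
  rw [h2]
  exact mul_le_of_le_one_left (inv_pos.2 ht).le (by linarith [Real.exp_pos (-t)])

/-- Lemma 3.2 (boundsol2): properties of the solution of the Stein equation for the
exponential law, version 2.  Here `f x = (e^{-(t-x)⁺} - e^{-t})/x` on `(0,∞)`, and
`f'` denotes the derivative (left-hand derivative at `x = t`); `f''` is the
(left-hand) derivative of `f'`. -/
theorem stein_solution_exponential_v2
    (t : ℝ) (ht : 0 < t)
    (f f' : ℝ → ℝ)
    (hf : ∀ x, f x = (Real.exp (-(max (t - x) 0)) - Real.exp (-t)) / x)
    (hf' : ∀ x, f' x =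
      if x ≤ t then (x * Real.exp x - Real.exp x + 1) / x ^ 2 * Real.exp (-t)
      else (Real.exp (-t) - 1) / x ^ 2) :
    (∀ x, 0 < x → x ≠ t → HasDerivAt f (f' x) x) ∧
    HasDerivWithinAt f (f' t) (Set.Iic t) t ∧
    (∀ x, 0 < x →
      x * f' x - (x - 1) * f x = (if x ≤ t then (1 : ℝ) else 0) - (1 - Real.exp (-t))) ∧
    (∀ x, 0 < x → |f' x| ≤ t⁻¹) ∧
    (∀ x, 0 < x → x ≠ t → ∃ d, HasDerivAt f' d x ∧ |d| ≤ max t⁻¹ (2 / t ^ 2)) ∧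
    (∃ d, HasDerivWithinAt f' d (Set.Iic t) t ∧ |d| ≤ max t⁻¹ (2 / t ^ 2)) ∧
    (∀ x, 0 < x → 0 ≤ f x ∧ f x ≤ (1 - Real.exp (-t)) / t) ∧
    ((1 - Real.exp (-t)) / t ≤ 1) ∧
    (∀ x, 0 < x → x ≤ t → 0 ≤ f' x) ∧
    (∀ x, t < x → f' x ≤ 0) := by
  have hE : 0 < exp (-t) := Real.exp_pos _
  have hE1 : exp (-t) < 1 := by simpa using ht
  have hEt : 1 - exp (-t) ≤ t := by linarith [Real.add_one_le_exp (-t)]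
  have hmul : exp t * exp (-t) = 1 := by rw [← Real.exp_add]; simp
  have hfl : ∀ x, x ≤ t → f x = (exp x - 1) / x * exp (-t) := by
    intro x hx
    have h : exp (-(t - x)) = exp x * exp (-t) := by rw [← Real.exp_add]; ring_nf
    rw [hf, max_eq_left (sub_nonneg.2 hx), h]
    ring
  have hfr : ∀ x, t < x → f x = (1 - exp (-t)) / x := by
    intro x hx
    rw [hf, max_eq_right (by linarith)]
    simp
  have hfl' : ∀ x, x ≤ t → f' x = (x * exp x - exp x + 1) / x ^ 2 * exp (-t) :=
    fun x hx => by rw [hf', if_pos hx]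
  have hfr' : ∀ x, t < x → f' x = (exp (-t) - 1) / x ^ 2 :=
    fun x hx => by rw [hf', if_neg hx.not_ge]
  have hbound : ∀ {c x : ℝ}, 0 < x → x ≤ t → c ≤ (exp x - 1) / x → c * exp (-t) ≤ t⁻¹ :=
    fun hx hxt hc => (mul_le_mul_of_nonneg_right
      (hc.trans (exp_sub_one_div_le_of_le hx hxt)) hE.le).trans
        (exp_sub_one_div_mul_exp_neg_le_inv ht)
  have hsecond : ∀ x, 0 < x → x ≤ t →
      |(x ^ 2 * exp x - 2 * x * exp x + 2 * exp x - 2) / x ^ 3 * exp (-t)|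
        ≤ max t⁻¹ (2 / t ^ 2) := by
    intro x hx hxt
    have h := sq_mul_exp_sub_nonneg hx.le
    rw [abs_of_nonneg (by positivity)]
    exact (hbound hx hxt (second_deriv_exp_sub_one_div_le hx)).trans (le_max_left _ _)
  have hpos : ∀ x, 0 < x → x ≤ t → 0 ≤ f' x := by
    intro x _ hxt
    have h := mul_exp_sub_exp_add_one_nonneg x
    rw [hfl' x hxt]
    positivity
  have hneg : ∀ x, t < x → f' x ≤ 0 := by
    intro x hx
    rw [hfr' x hx]
    exact div_nonpos_of_nonpos_of_nonneg (by linarith) (sq_nonneg x)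
  refine ⟨?_, ?_, ?_, ?_, ?_, ?_, ?_, ?_, hpos, hneg⟩
  · intro x hx hxt
    rcases lt_or_gt_of_ne hxt with h | h
    · rw [hfl' x h.le]
      refine ((hasDerivAt_exp_sub_one_div hx.ne').mul_const _).congr_of_eventuallyEq ?_
      filter_upwards [Iio_mem_nhds h] with y hy using hfl y (le_of_lt hy)
    · have hd : HasDerivAt (fun y : ℝ => (1 - exp (-t)) / y) (f' x) x := by
        rw [hfr' x h]
        refine HasDerivAt.congr_deriv
          ((hasDerivAt_const x (1 - exp (-t))).fun_div (hasDerivAt_id' x) hx.ne') ?_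
        ring
      refine hd.congr_of_eventuallyEq ?_
      filter_upwards [Ioi_mem_nhds h] with y hy using hfr y hy
  · rw [hfl' t le_rfl]
    exact ((hasDerivAt_exp_sub_one_div ht.ne').mul_const _).hasDerivWithinAt.congr
      (fun y hy => hfl y hy) (hfl t le_rfl)
  · intro x hx
    rcases le_or_gt x t with h | h
    · rw [hfl x h, hfl' x h, if_pos h]
      field_simp
      ring
    · rw [hfr x h, hfr' x h, if_neg h.not_ge]
      field_simp
      ring
  · intro x hx
    rcases le_or_gt x t with h | h
    · rw [abs_of_nonneg (hpos x hx h), hfl' x h]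
      exact hbound hx h (deriv_exp_sub_one_div_le hx)
    · rw [abs_of_nonpos (hneg x h), hfr' x h, ← neg_div, neg_sub, inv_eq_one_div,
        div_le_div_iff₀ (by positivity) ht]
      nlinarith
  · intro x hx hxt
    rcases lt_or_gt_of_ne hxt with h | h
    · refine ⟨_, ((hasDerivAt_deriv_exp_sub_one_div hx.ne').mul_const
        (exp (-t))).congr_of_eventuallyEq ?_, hsecond x hx h.le⟩
      filter_upwards [Iio_mem_nhds h] with y hy using hfl' y (le_of_lt hy)
    · have hd : HasDerivAt (fun y : ℝ => (exp (-t) - 1) / y ^ 2)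
          (2 * (1 - exp (-t)) / x ^ 3) x := by
        refine HasDerivAt.congr_deriv ((hasDerivAt_const x (exp (-t) - 1)).fun_div (hasDerivAt_pow 2 x)
          (pow_ne_zero 2 hx.ne')) ?_
        push_cast
        field_simp
        ring
      refine ⟨_, hd.congr_of_eventuallyEq ?_, ?_⟩
      · filter_upwards [Ioi_mem_nhds h] with y hy using hfr' y hy
      · have h1 : 0 ≤ 1 - exp (-t) := by linarith
        rw [abs_of_nonneg (by positivity)]
        refine le_trans ?_ (le_max_right _ _)
        calc 2 * (1 - exp (-t)) / x ^ 3 ≤ 2 * t / t ^ 3 := by gcongr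
          _ = 2 / t ^ 2 := by field_simp
  · exact ⟨_, ((hasDerivAt_deriv_exp_sub_one_div ht.ne').mul_const
      (exp (-t))).hasDerivWithinAt.congr (fun y hy => hfl' y hy) (hfl' t le_rfl),
      hsecond t ht le_rfl⟩
  · intro x hx
    have h1 : 0 ≤ 1 - exp (-t) := by linarith
    rcases le_or_gt x t with h | h
    · have h2 : (1 - exp (-t)) / t = (exp t - 1) / t * exp (-t) := by
        linear_combination -t⁻¹ * hmul
      have h3 : 0 ≤ exp x - 1 := by linarith [Real.one_le_exp hx.le]
      rw [hfl x h, h2]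
      exact ⟨by positivity,
        mul_le_mul_of_nonneg_right (exp_sub_one_div_le_of_le hx h) hE.le⟩
    · rw [hfr x h]
      exact ⟨by positivity, by gcongr⟩
  · rwa [div_le_one ht]
end
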